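/- arXiv:2302.01638 — 2 statements merged into one kernel-verified Lean document; each statement's English description precedes it below -/
import Mathlib

section
/- Let G be a 2-connected chordless graph. If G is not 2-sparse, then G admits a proper 2-cutset. -/
open SimpleGraph

noncomputable def edeg {V : Type*} (G : SimpleGraph V) (v : V) : ℕ :=
  {u | G.Adj v u}.ncard

def IsProperEdgeColoring {V : Type*} (G : SimpleGraph V) (c : Sym2 V → ℕ) : Prop :=
  ∀ e₁ ∈ G.edgeSet, ∀ e₂ ∈ G.edgeSet, e₁ ≠ e₂ → (∃ v, v ∈ e₁ ∧ v ∈ e₂) → c e₁ ≠ c e₂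

def IsAcyclicEdgeColoring {V : Type*} (G : SimpleGraph V) (c : Sym2 V → ℕ) : Prop :=
  IsProperEdgeColoring G c ∧
  ∀ (v : V) (w : G.Walk v v), w.IsCycle →
    ¬ ∃ α β : ℕ, ∀ e ∈ w.edges, c e = α ∨ c e = β

noncomputable def acyclicChromaticIndex {V : Type*} (G : SimpleGraph V) : ℕ :=
  sInf {n | ∃ c : Sym2 V → ℕ, IsAcyclicEdgeColoring G c ∧ ∀ e ∈ G.edgeSet, c e < n}

def Chordless {V : Type*} (G : SimpleGraph V) : Prop :=
  ∀ u v : V, G.Adj u v →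
    ¬ ∃ (x : V) (w : (G.deleteEdges {s(u, v)}).Walk x x),
        w.IsCycle ∧ u ∈ w.support ∧ v ∈ w.support

def TwoSparse {V : Type*} (G : SimpleGraph V) : Prop :=
  ∀ u v, G.Adj u v → edeg G u ≤ 2 ∨ edeg G v ≤ 2

def TwoConnected {V : Type*} [Fintype V] (G : SimpleGraph V) : Prop :=
  3 ≤ Fintype.card V ∧ ∀ v : V, (G.induce {u | u ≠ v}).Connected

def IsLinearForest {α : Type*} (H : SimpleGraph α) : Prop :=
  H.IsAcyclic ∧ ∀ v, edeg H v ≤ 2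

def IsPathGraph {α : Type*} (H : SimpleGraph α) : Prop :=
  H.Connected ∧ IsLinearForest H

def IsSplit {V : Type*} (G : SimpleGraph V) (X Y : Set V) (a b : V) : Prop :=
  a ≠ b ∧ ¬ G.Adj a b ∧ X.Nonempty ∧ Y.Nonempty ∧
  a ∉ X ∧ a ∉ Y ∧ b ∉ X ∧ b ∉ Y ∧ Disjoint X Y ∧
  X ∪ Y ∪ {a, b} = Set.univ ∧
  (∀ x ∈ X, ∀ y ∈ Y, ¬ G.Adj x y) ∧
  (G.induce (X ∪ {a, b})).Reachable ⟨a, by simp⟩ ⟨b, by simp⟩ ∧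
  (G.induce (Y ∪ {a, b})).Reachable ⟨a, by simp⟩ ⟨b, by simp⟩ ∧
  ¬ IsPathGraph (G.induce (X ∪ {a, b})) ∧
  ¬ IsPathGraph (G.induce (Y ∪ {a, b}))

lemma aux_append {V : Type*} {G : SimpleGraph V} {a b c : V} (p : G.Walk a b) (q : G.Walk b c)
    (hp : p.IsPath) (hq : q.IsPath) (h : ∀ z ∈ p.support, z ∈ q.support → z = b) :
    (p.append q).IsPath := by
  induction p with
  | nil => simpa using hq
  | @cons a' b' c' e r ih =>
    rw [Walk.cons_isPath_iff] at hp
    rw [Walk.cons_append, Walk.cons_isPath_iff]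
    refine ⟨ih q hp.1 hq (fun z hz hz' => h z (by simp [hz]) hz'), ?_⟩
    rw [Walk.mem_support_append_iff]
    rintro (h1 | h1)
    · exact hp.2 h1
    · have := h a' (by simp) h1
      subst this
      exact hp.2 r.end_mem_support

/-- Truncate a walk at its first vertex in a set. -/
lemma aux_first {V : Type*} {G : SimpleGraph V} {a b v : V} (S : Set V) (p : G.Walk a b)
    (hp : p.IsPath) (hv : v ∉ p.support) (hb : b ∈ S) :
    ∃ (c : V) (q : G.Walk a c), c ∈ S ∧ q.IsPath ∧ v ∉ q.support ∧ (∀ z ∈ q.support, z ∈ p.support) ∧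
      ∀ z ∈ q.support, z ∈ S → z = c := by
  induction p with
  | @nil u => exact ⟨u, .nil, hb, by simp, hv, by simp, by simp⟩
  | @cons a' b' c' e r ih =>
    by_cases ha : a' ∈ S
    · refine ⟨a', .nil, ha, by simp, ?_, by simp, by simp⟩
      simp at hv ⊢
      exact hv.1
    · rw [Walk.cons_isPath_iff] at hp
      rw [Walk.support_cons, List.mem_cons, not_or] at hv
      obtain ⟨c, q, hc, hq, hvq, hsub, hS⟩ := ih hp.1 hv.2 hb
      refine ⟨c, .cons e q, hc, ?_, ?_, ?_, ?_⟩
      · rw [Walk.cons_isPath_iff]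
        exact ⟨hq, fun h => hp.2 (hsub _ h)⟩
      · simp [hvq, hv.1]
      · intro z hz
        rw [Walk.support_cons, List.mem_cons] at hz ⊢
        exact hz.imp id (hsub z)
      · intro z hz hzS
        rw [Walk.support_cons, List.mem_cons] at hz
        rcases hz with rfl | hz
        · exact absurd hzS ha
        · exact hS z hz hzS

lemma aux_stay {V : Type*} {G : SimpleGraph V} {a w x : V} (S : Set V) (p : G.Walk a w)
    (hp : p.IsPath) (hx : x ∉ p.support) (ha : a ∈ S)
    (hS : ∀ s ∈ S, ∀ t, G.Adj s t → t ≠ x → t ≠ w → t ∈ S) :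
    ∀ z ∈ p.support, z ∈ S ∨ z = w := by
  induction p with
  | nil => simp
  | @cons a' b' c' e r ih =>
    rw [Walk.cons_isPath_iff] at hp
    rw [Walk.support_cons, List.mem_cons, not_or] at hx
    intro z hz
    rw [Walk.support_cons, List.mem_cons] at hz
    rcases hz with rfl | hz
    · exact Or.inl ha
    by_cases hb : b' = c'
    · subst hb
      have := (Walk.isPath_iff_eq_nil (p := r)).1 hp.1
      subst this
      right; simpa using hz
    · exact ih hp.1 hx.2 (hS a' ha b' e (fun h => hx.2 (h ▸ r.start_mem_support)) hb) hS z hz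

/-- Whitney: in a 2-connected graph any two vertices lie on a common cycle. -/
lemma aux_whitney {V : Type*} {H : SimpleGraph V}
    (hc : ∀ v a b, a ≠ v → b ≠ v → ∃ p : H.Walk a b, p.IsPath ∧ v ∉ p.support)
    (ht : ∀ a b : V, ∃ c, c ≠ a ∧ c ≠ b) {u x : V} (p : H.Walk u x) (hne : u ≠ x) :
    ∃ c : H.Walk u u, c.IsCycle ∧ x ∈ c.support := by
  classical
  induction p with
  | nil => exact absurd rfl hne
  | @cons u v x e r ih =>
    by_cases hvx : v = x
    · subst hvx
      obtain ⟨z, hz1, hz2⟩ := ht u v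
      obtain ⟨p1, -, h1⟩ := hc u v z hne.symm hz1
      obtain ⟨p2, -, h2⟩ := hc v z u hz2 hne
      have hed : s(u, v) ∉ (p1.append p2).edges := by
        rw [Walk.edges_append, List.mem_append]
        rintro (h | h)
        · exact h1 (Walk.fst_mem_support_of_mem_edges _ h)
        · exact h2 (Walk.snd_mem_support_of_mem_edges _ h)
      refine ⟨.cons e (p1.append p2).bypass, ?_, by simp⟩
      rw [Walk.cons_isCycle_iff]
      exact ⟨Walk.bypass_isPath _, fun h => hed (Walk.edges_bypass_subset_edges _ h)⟩
    · obtain ⟨c, hcy, hx⟩ := ih hvx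
      by_cases hu : u ∈ c.support
      · exact ⟨c.rotate u hu, by simpa using hcy, by simpa using hx⟩
      have huv : u ≠ v := e.ne
      obtain ⟨q0, hq0, hvq0⟩ := hc v u x huv (Ne.symm hvx)
      obtain ⟨p, Q, hpS, hQ, hvQ, -, hfirst⟩ := aux_first {z | z ∈ c.support} q0 hq0 hvq0 hx
      have hpv : p ≠ v := fun h => hvQ (h ▸ Q.end_mem_support)
      -- an arc from p to v through x
      have harc : ∃ A : H.Walk p v, A.IsPath ∧ x ∈ A.support ∧ ∀ z ∈ A.support, z ∈ c.support := by
        have hsp := c.take_spec hpS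
        have hn1 : ¬ (c.takeUntil p hpS).Nil := fun h => hpv h.eq.symm
        have hn2 : ¬ (c.dropUntil p hpS).Nil := fun h => hpv h.eq
        have hx' := hx
        rw [← hsp] at hx' hcy
        rw [Walk.mem_support_append_iff] at hx'
        rcases hx' with h | h
        · refine ⟨(c.takeUntil p hpS).reverse, (hcy.isPath_of_append_left hn2).reverse,
            by simpa using h, fun z hz => ?_⟩
          rw [Walk.support_reverse, List.mem_reverse] at hz
          exact c.support_takeUntil_subset_support hpS hz
        · exact ⟨_, hcy.isPath_of_append_right hn1, h,
            fun z hz => c.support_dropUntil_subset_support hpS hz⟩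
      obtain ⟨A, hA, hxA, hAc⟩ := harc
      have hP : (Q.append A).IsPath := aux_append Q A hQ hA (fun z hz hz' => hfirst z hz (hAc z hz'))
      refine ⟨.cons e (Q.append A).reverse, ?_, ?_⟩
      · rw [Walk.cons_isCycle_iff]
        refine ⟨hP.reverse, ?_⟩
        rw [Walk.edges_reverse, List.mem_reverse, Walk.edges_append, List.mem_append]
        rintro (h | h)
        · exact hvQ (Walk.snd_mem_support_of_mem_edges _ h)
        · exact hu (hAc _ (Walk.fst_mem_support_of_mem_edges _ h))
      · simp [hxA]

lemma aux_conn {V : Type*} [Fintype V] {G : SimpleGraph V} (h2c : TwoConnected G) (v a b : V)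
    (ha : a ≠ v) (hb : b ≠ v) : ∃ p : G.Walk a b, p.IsPath ∧ v ∉ p.support := by
  classical
  obtain ⟨p⟩ := (h2c.2 v).preconnected ⟨a, ha⟩ ⟨b, hb⟩
  have hp : v ∉ (p.map (Embedding.induce {u | u ≠ v}).toHom).support := by
    rw [Walk.support_map]
    simp
  exact ⟨_, Walk.bypass_isPath (p.map (Embedding.induce {u | u ≠ v}).toHom),
    fun h => hp (Walk.support_bypass_subset_support _ h)⟩

lemma aux_third {V : Type*} [Fintype V] {G : SimpleGraph V} (h2c : TwoConnected G) (a b : V) :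
    ∃ c, c ≠ a ∧ c ≠ b := by
  classical
  have h : ({a, b} : Finset V).card < (Finset.univ : Finset V).card := by
    have := Finset.card_le_two (a := a) (b := b)
    have := h2c.1
    rw [Finset.card_univ]; omega
  obtain ⟨c, -, hc⟩ := Finset.exists_mem_notMem_of_card_lt_card h
  exact ⟨c, by simpa using hc⟩

lemma aux_nbr {V : Type*} [Fintype V] {G : SimpleGraph V} (h2c : TwoConnected G) (v a : V) :
    ∃ b, b ≠ a ∧ G.Adj v b := by
  have key : ∀ a, a ≠ v → ∃ b, b ≠ a ∧ G.Adj v b := by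
    intro a hav
    obtain ⟨z, hz1, hz2⟩ := aux_third h2c v a
    obtain ⟨p, -, hp⟩ := aux_conn h2c a v z hav.symm hz2
    cases p with
    | nil => exact absurd rfl hz1
    | @cons _ b _ e r =>
      refine ⟨b, ?_, e⟩
      rintro rfl
      simp at hp
  by_cases hav : a = v
  · obtain ⟨z, hz1, -⟩ := aux_third h2c v a
    obtain ⟨b, -, hb⟩ := key z hz1
    exact ⟨b, hav ▸ hb.ne', hb⟩
  · exact key a hav

lemma aux_nbr3 {V : Type*} [Fintype V] {G : SimpleGraph V} {v : V} (h : ¬ edeg G v ≤ 2) (a b : V) :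
    ∃ c, c ≠ a ∧ c ≠ b ∧ G.Adj v c := by
  by_contra! hcon
  apply h
  calc edeg G v ≤ ({a, b} : Set V).ncard := by
        apply Set.ncard_le_ncard _ (Set.toFinite _)
        intro c hc
        by_contra hn
        simp only [Set.mem_insert_iff, Set.mem_singleton_iff, not_or] at hn
        exact hcon c hn.1 hn.2 hc
    _ ≤ 2 := by
        have := Set.ncard_insert_le a {b}
        simpa using this

lemma aux_sep {V : Type*} [Fintype V] {G : SimpleGraph V} (h2c : TwoConnected G)
    (hch : Chordless G) {x y : V} (hxy : G.Adj x y) :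
    ∃ w, w ≠ x ∧ w ≠ y ∧ ∀ p : (G.deleteEdges {s(x, y)}).Walk x y, w ∈ p.support := by
  classical
  by_contra! hcon
  have hc : ∀ v a b, a ≠ v → b ≠ v →
      ∃ p : (G.deleteEdges {s(x, y)}).Walk a b, p.IsPath ∧ v ∉ p.support := by
    intro v a b ha hb
    obtain ⟨p, -, hv⟩ := aux_conn h2c v a b ha hb
    have : ∃ p : (G.deleteEdges {s(x, y)}).Walk a b, v ∉ p.support := by
      clear ha hb
      induction p with
      | @nil u => exact ⟨.nil, by simpa using hv⟩
      | @cons a c b e r ih =>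
        rw [Walk.support_cons, List.mem_cons, not_or] at hv
        obtain ⟨q, hq⟩ := ih hv.2
        have hvc : v ≠ c := fun h => hv.2 (h ▸ r.start_mem_support)
        have hs : ∃ q : (G.deleteEdges {s(x, y)}).Walk a c, v ∉ q.support := by
          by_cases he : s(a, c) = s(x, y)
          · rcases Sym2.eq_iff.1 he with ⟨rfl, rfl⟩ | ⟨rfl, rfl⟩
            · exact hcon v hv.1 hvc
            · obtain ⟨q, hq⟩ := hcon v hvc hv.1
              exact ⟨q.reverse, by simpa using hq⟩
          · have e' : (G.deleteEdges {s(x, y)}).Adj a c := by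
              rw [deleteEdges_adj]; exact ⟨e, he⟩
            exact ⟨.cons e' .nil, by simp [hv.1, hvc]⟩
        obtain ⟨q', hq'⟩ := hs
        exact ⟨q'.append q, by rw [Walk.mem_support_append_iff]; tauto⟩
    obtain ⟨q, hq⟩ := this
    exact ⟨q.bypass, Walk.bypass_isPath _, fun h => hq (Walk.support_bypass_subset_support _ h)⟩
  obtain ⟨z, hz1, hz2⟩ := aux_third h2c x y
  obtain ⟨p, -, -⟩ := hc z x y hz1.symm hz2.symm
  obtain ⟨c, hcy, hyc⟩ := aux_whitney hc (aux_third h2c) p hxy.ne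
  exact hch x y hxy ⟨x, c, hcy, c.start_mem_support, hyc⟩

theorem stmt7 {V : Type*} [Fintype V] (G : SimpleGraph V) (h2c : TwoConnected G)
    (hch : Chordless G) (hns : ¬ TwoSparse G) :
    ∃ (X Y : Set V) (a b : V), IsSplit G X Y a b := by
  classical
  unfold TwoSparse at hns
  push Not at hns
  obtain ⟨x, y, hxy, hx3, hy3⟩ := hns
  rw [← not_le] at hx3 hy3
  obtain ⟨w, hwx, hwy, hw⟩ := aux_sep h2c hch hxy
  set C : Set V := {v | ∃ p : (G.deleteEdges {s(x, y)}).Walk x v, w ∉ p.support} with hC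
  have hxC : x ∈ C := ⟨.nil, by simpa using hwx⟩
  have hyC : y ∉ C := fun ⟨p, hp⟩ => hp (hw p)
  have hwC : w ∉ C := fun ⟨p, hp⟩ => hp p.end_mem_support
  have hstep : ∀ s ∈ C, ∀ t, G.Adj s t → s(s, t) ≠ s(x, y) → t ≠ w → t ∈ C := by
    rintro s ⟨p, hp⟩ t hst hne htw
    have e' : (G.deleteEdges {s(x, y)}).Adj s t := by
      rw [deleteEdges_adj]; exact ⟨hst, hne⟩
    refine ⟨p.concat e', ?_⟩
    rw [Walk.support_concat]
    simp [hp, htw.symm]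
  set X : Set V := C \ {x} with hX
  set Y : Set V := {v | v ∉ C ∧ v ≠ w} with hY
  have hyY : y ∈ Y := ⟨hyC, hwy.symm⟩
  have hXcl : ∀ s ∈ X, ∀ t, G.Adj s t → t ≠ x → t ≠ w → t ∈ X := by
    rintro s ⟨hs, hsx⟩ t hst htx htw
    refine ⟨hstep s hs t hst ?_ htw, htx⟩
    intro h
    rcases Sym2.eq_iff.1 h with ⟨h1, h2⟩ | ⟨h1, h2⟩
    · exact hsx h1
    · exact htx h2
  have hYcl : ∀ s ∈ Y, ∀ t, G.Adj s t → t ≠ x → t ≠ w → t ∈ Y := by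
    rintro s ⟨hs, hsw⟩ t hst htx htw
    refine ⟨fun htC => hs ?_, htw⟩
    by_cases h : s(t, s) = s(x, y)
    · rcases Sym2.eq_iff.1 h with ⟨h1, h2⟩ | ⟨h1, h2⟩
      · exact absurd h1 htx
      · exact h2 ▸ hxC
    · exact hstep t htC s hst.symm h hsw
  have hxn : ∀ t, G.Adj x t → t ≠ y → t ≠ w → t ∈ X := by
    intro t ht hty htw
    refine ⟨hstep x hxC t ht ?_ htw, ht.ne'⟩
    intro h
    rcases Sym2.eq_iff.1 h with ⟨h1, h2⟩ | ⟨h1, h2⟩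
    · exact hty h2
    · exact hxy.ne h1
  obtain ⟨x', hx'y, hx'w, hxx'⟩ := aux_nbr3 hx3 y w
  have hx'X : x' ∈ X := hxn x' hxx' hx'y hx'w
  obtain ⟨P1, hP1, hxP1⟩ := aux_conn h2c x y w hxy.ne' hwx
  obtain ⟨P2, hP2, hxP2⟩ := aux_conn h2c x x' w hxx'.ne' hwx
  have hS1 := aux_stay Y P1 hP1 hxP1 hyY hYcl
  have hS2 := aux_stay X P2 hP2 hxP2 hx'X hXcl
  have hdis : Disjoint X Y := by
    rw [Set.disjoint_left]
    rintro z ⟨hz, -⟩ ⟨hz', -⟩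
    exact hz' hz
  have hxw : ¬ G.Adj x w := by
    intro hxw
    have hR : (P1.append P2.reverse).IsPath := by
      apply aux_append P1 P2.reverse hP1 hP2.reverse
      intro z hz hz'
      rw [Walk.support_reverse, List.mem_reverse] at hz'
      rcases hS1 z hz with h | h
      · rcases hS2 z hz' with h' | h'
        · exact absurd h (Set.disjoint_left.1 hdis h')
        · exact h'
      · exact h
    have hxR : x ∉ (P1.append P2.reverse).support := by
      rw [Walk.mem_support_append_iff]; simp [hxP1, hxP2]
    set R := P1.append P2.reverse with hRdef
    have hwR : w ∈ R.support := by simp [hRdef, Walk.mem_support_append_iff]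
    have hcyc : (Walk.cons hxy (R.concat hxx'.symm)).IsCycle := by
      rw [Walk.cons_isCycle_iff]
      refine ⟨hR.concat hxR _, ?_⟩
      rw [Walk.edges_concat]
      simp only [List.concat_eq_append, List.mem_append, List.mem_singleton]
      rintro (h | h)
      · exact hxR (Walk.fst_mem_support_of_mem_edges _ h)
      · rcases Sym2.eq_iff.1 h with ⟨h1, h2⟩ | ⟨h1, h2⟩
        · exact hxy.ne h2.symm
        · exact hx'y h2.symm
    have hE : s(x, w) ∉ (Walk.cons hxy (R.concat hxx'.symm)).edges := by
      rw [Walk.edges_cons, Walk.edges_concat]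
      simp only [List.concat_eq_append, List.mem_cons, List.mem_append, List.not_mem_nil, or_false]
      rintro (h | h | h)
      · rcases Sym2.eq_iff.1 h with ⟨h1, h2⟩ | ⟨h1, h2⟩
        · exact hwy h2
        · exact hwx h2
      · exact hxR (Walk.fst_mem_support_of_mem_edges _ h)
      · rcases Sym2.eq_iff.1 h with ⟨h1, h2⟩ | ⟨h1, h2⟩
        · exact hwx h2
        · exact hx'w h2.symm
    have htr : ∀ e ∈ (Walk.cons hxy (R.concat hxx'.symm)).edges,
        e ∈ (G.deleteEdges {s(x, w)}).edgeSet := by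
      intro e he
      rw [edgeSet_deleteEdges]
      exact ⟨Walk.edges_subset_edgeSet _ he, fun h => hE (by rw [Set.mem_singleton_iff] at h; exact h ▸ he)⟩
    refine hch x w hxw ⟨x, _, hcyc.transfer htr, ?_, ?_⟩
    · simp
    · rw [Walk.support_transfer, Walk.support_cons, Walk.support_concat]
      simp [hwR]
  refine ⟨X, Y, x, w, hwx.symm, hxw, ⟨x', hx'X⟩, ⟨y, hyY⟩, by simp [hX], by simp [hY, hxC],
    by simp [hX, hwC], by simp [hY], hdis, ?_, ?_, ?_, ?_, ?_, ?_⟩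
  · ext v
    simp only [hX, hY, Set.mem_union, Set.mem_diff, Set.mem_singleton_iff, Set.mem_setOf_eq,
      Set.mem_insert_iff, Set.mem_univ, iff_true]
    tauto
  · intro s hs t ht hst
    have := hXcl s hs t hst (fun h => ht.1 (h ▸ hxC)) ht.2
    exact Set.disjoint_left.1 hdis this ht
  · refine ⟨(Walk.cons hxx' P2).induce _ ?_⟩
    intro z hz
    rw [Walk.support_cons, List.mem_cons] at hz
    rcases hz with rfl | hz
    · simp
    · rcases hS2 z hz with h | h
      · exact Or.inl h
      · simp [h]
  · refine ⟨(Walk.cons hxy P1).induce _ ?_⟩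
    intro z hz
    rw [Walk.support_cons, List.mem_cons] at hz
    rcases hz with rfl | hz
    · simp
    · rcases hS1 z hz with h | h
      · exact Or.inl h
      · simp [h]
  · rintro ⟨hcon, hac, -⟩
    have hT : (G.induce (X ∪ {x, w})).IsTree := ⟨hcon, hac⟩
    haveI : Nontrivial ↥(X ∪ {x, w}) :=
      ⟨⟨⟨x, by simp⟩, ⟨w, by simp⟩, fun h => hwx (congrArg Subtype.val h).symm⟩⟩
    have hkey : ∀ v : ↥(X ∪ {x, w}), v.1 ≠ w → (G.induce (X ∪ {x, w})).degree v ≠ 1 := by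
      rintro ⟨v, hv⟩ hvw hd
      rw [degree_eq_one_iff_existsUnique_adj] at hd
      obtain ⟨⟨b, hb⟩, -, huniq⟩ := hd
      have : ∃ c, c ≠ b ∧ G.Adj v c ∧ c ∈ X ∪ {x, w} := by
        rcases hv with hv | hv
        · obtain ⟨c, hcb, hvc⟩ := aux_nbr h2c v b
          refine ⟨c, hcb, hvc, ?_⟩
          by_cases h1 : c = x
          · simp [h1]
          by_cases h2 : c = w
          · simp [h2]
          exact Or.inl (hXcl v hv c hvc h1 h2)
        · have hvx : v = x := by
            rcases hv with h | h
            · exact h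
            · exact absurd h hvw
          subst hvx
          obtain ⟨c, hcb, hcy, hvc⟩ := aux_nbr3 hx3 b y
          exact ⟨c, hcb, hvc, Or.inl (hxn c hvc hcy (fun h => hxw (h ▸ hvc)))⟩
      obtain ⟨c, hcb, hvc, hcm⟩ := this
      exact hcb (congrArg Subtype.val (huniq ⟨c, hcm⟩ hvc))
    obtain ⟨u, v, huv, hu, hv⟩ := hT.exists_ne_and_degree_eq_one
    by_cases huw : u.1 = w
    · exact hkey v (fun h => huv (Subtype.ext (huw.trans h.symm))) hv
    · exact hkey u huw hu
  · rintro ⟨-, -, hdeg⟩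
    apply hy3
    refine le_trans ?_ (hdeg ⟨y, Or.inl hyY⟩)
    unfold edeg
    rw [← Set.ncard_image_of_injective _ Subtype.val_injective]
    apply Set.ncard_le_ncard _ (Set.toFinite _)
    intro c hc
    have hcm : c ∈ Y ∪ {x, w} := by
      by_cases h1 : c = x
      · simp [h1]
      by_cases h2 : c = w
      · simp [h2]
      exact Or.inl (hYcl y hyY c hc h1 h2)
    exact ⟨⟨c, hcm⟩, hc, rfl⟩
end

section
/- Let G be a 2-connected, not 2-sparse chordless graph. Then there exists a split (X, Y, a, b) of a proper 2-cutset of G such that (i) the block G_X(a,b) is 2-sparse, (ii) G_X(a,b) is not isomorphic to K_{2,t} for any t ≥ 3, and (iii) in G_X(a,b), deg(a) ≥ 3 and either deg(b) ≥ 3, or deg(b) = 2 and X is minimal among all such splits. -/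
open SimpleGraph

def blockX {V : Type*} (G : SimpleGraph V) (X : Set V) (a b : V) :
    SimpleGraph (Option ↥(X ∪ {a, b})) :=
  SimpleGraph.fromRel fun x y =>
    match x, y with
    | some u, some v => G.Adj u v
    | none, some v => (v : V) = a ∨ (v : V) = b
    | _, _ => False

theorem cut_of_reach {V : Type*} {G : SimpleGraph V} {S : Set V} {s t : ↥S}
    (h : (G.induce S).Reachable s t) (A : Set V) (hs : (s : V) ∈ A) (ht : (t : V) ∉ A) :
    ∃ p q, p ∈ A ∧ q ∉ A ∧ p ∈ S ∧ q ∈ S ∧ G.Adj p q := by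
  obtain ⟨w⟩ := h
  obtain ⟨d, -, h1, h2⟩ := w.exists_boundary_dart (Subtype.val ⁻¹' A) hs ht
  exact ⟨d.fst, d.snd, h1, h2, d.fst.2, d.snd.2, d.adj⟩

theorem reach_of_cut' {V : Type*} {G : SimpleGraph V} {s t : V}
    (h : ∀ A : Set V, s ∈ A → t ∉ A → ∃ p q, p ∈ A ∧ q ∉ A ∧ G.Adj p q) :
    G.Reachable s t := by
  by_contra hn
  obtain ⟨p, q, hp, hq, hpq⟩ := h {x | G.Reachable s x} (Reachable.refl s) hn
  exact hq (Reachable.trans hp hpq.reachable)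

theorem reach_of_cut {V : Type*} {G : SimpleGraph V} {S : Set V} {s t : ↥S}
    (h : ∀ A : Set V, A ⊆ S → (s : V) ∈ A → (t : V) ∉ A →
      ∃ p q, p ∈ A ∧ q ∉ A ∧ q ∈ S ∧ G.Adj p q) :
    (G.induce S).Reachable s t := by
  apply reach_of_cut'
  intro A hs ht
  obtain ⟨p, q, ⟨p', hp, rfl⟩, hq, hqS, hpq⟩ := h (Subtype.val '' A) (by simp)
    ⟨s, hs, rfl⟩ (by simpa using ht)
  exact ⟨p', ⟨q, hqS⟩, hp, fun hh => hq ⟨_, hh, rfl⟩, hpq⟩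

theorem TwoConnected.cut {V : Type*} [Fintype V] {G : SimpleGraph V} (h : TwoConnected G)
    (c : V) (A : Set V) {s t : V} (hs : s ∈ A) (ht : t ∉ A) (hsc : s ≠ c) (htc : t ≠ c) :
    ∃ p q, p ∈ A ∧ q ∉ A ∧ p ≠ c ∧ q ≠ c ∧ G.Adj p q :=
  cut_of_reach ((h.2 c).preconnected ⟨s, hsc⟩ ⟨t, htc⟩) A hs ht

theorem walk_out {V : Type*} {G : SimpleGraph V} {S : Set V} {s t : ↥S}
    (p : (G.induce S).Walk s t) : ∃ q : G.Walk (s : V) (t : V), ∀ w ∈ q.support, w ∈ S := by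
  induction p with
  | @nil a => exact ⟨Walk.nil, by simp⟩
  | @cons a b c h p ih =>
    obtain ⟨q, hq⟩ := ih
    have h' : G.Adj (a : V) (b : V) := h
    refine ⟨Walk.cons h' q, ?_⟩
    intro w hw
    rw [Walk.support_cons, List.mem_cons] at hw
    rcases hw with rfl | hw
    · exact a.2
    · exact hq w hw

theorem first_hit {V : Type*} {G : SimpleGraph V} (C : Set V) {s t : V} (p : G.Walk s t)
    (ht : t ∈ C) : ∃ z ∈ C, ∃ q : G.Walk z s, (∀ w ∈ q.support, w ∈ C → w = z) ∧
      q.support ⊆ p.support := by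
  induction p with
  | nil => exact ⟨_, ht, Walk.nil, by simp⟩
  | @cons a b c h p ih =>
    by_cases ha : a ∈ C
    · exact ⟨a, ha, Walk.nil, by simp, by simp⟩
    · obtain ⟨z, hz, q, h1, h2⟩ := ih ht
      refine ⟨z, hz, q.concat h.symm, ?_, ?_⟩
      · intro w hw hwC
        simp only [Walk.support_concat, List.mem_append, List.mem_singleton] at hw
        rcases hw with hw | rfl
        · exact h1 w hw hwC
        · exact absurd hwC ha
      · intro w hw
        simp only [Walk.support_concat, List.mem_append, List.mem_singleton] at hw
        rcases hw with hw | rfl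
        · simp [h2 hw]
        · simp

theorem third_vertex {V : Type*} [Fintype V] (h : 3 ≤ Fintype.card V) (x y : V) :
    ∃ z, z ≠ x ∧ z ≠ y := by
  classical
  by_contra hn
  push Not at hn
  have : (Finset.univ : Finset V) ⊆ {x, y} := by
    intro z _
    by_cases hz : z = x <;> simp [hz]
    exact hn z hz
  have h2 := Finset.card_le_card this
  have h3 := Finset.card_le_two (a := x) (b := y)
  simp only [Finset.card_univ] at h2
  omega

theorem whitney_base {V : Type*} [Fintype V] {H : SimpleGraph V} (h : TwoConnected H) (u : V) :
    ∃ (x : V) (w : H.Walk x x), w.IsCycle ∧ u ∈ w.support := by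
  obtain ⟨y, hy, -⟩ := third_vertex h.1 u u
  obtain ⟨y', hy', hyy'⟩ := third_vertex h.1 u y
  obtain ⟨p, z, hp, hz, -, -, hpz⟩ := h.cut y {u} (s := u) (t := y') rfl (by simpa using hy') hy.symm hyy'
  obtain rfl : p = u := hp
  have hzu : z ≠ p := hz
  obtain ⟨y2, hy2, hy2'⟩ := third_vertex h.1 p z
  obtain ⟨p', z', hp', hz', -, hzz', hpz'⟩ := h.cut z {p} (s := p) (t := y2) rfl (by simpa using hy2) hzu.symm hy2'
  obtain rfl : p' = p := hp'
  have hzu' : z' ≠ p' := hz'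
  have : (H \ fromEdgeSet {s(p', z)}).Reachable p' z := by
    apply reach_of_cut'
    intro A hA hzA
    by_cases hA' : z' ∈ A
    · obtain ⟨a, b, ha, hb, ha', hb', hab⟩ := h.cut p' A hA' hzA hzu' hzu
      refine ⟨a, b, ha, hb, ?_⟩
      simp [hab, ha', hb']
    · refine ⟨p', z', hA, hA', ?_⟩
      simp [hpz', hzz', hzu']
  obtain ⟨x, w, hw, hw'⟩ := adj_and_reachable_delete_edges_iff_exists_cycle.1 ⟨hpz, this⟩
  exact ⟨x, w, hw, w.fst_mem_support_of_mem_edges hw'⟩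

theorem arc {V : Type*} {G : SimpleGraph V} {x z u : V} (C : G.Walk x x) (hC : C.IsCycle)
    (hz : z ∈ C.support) (hzx : z ≠ x) (hu : u ∈ C.support) :
    ∃ A : G.Walk x z, A.IsPath ∧ A.support ⊆ C.support ∧ u ∈ A.support := by
  classical
  have hsp := C.take_spec hz
  have hu' := hu
  rw [← hsp, Walk.mem_support_append_iff] at hu'
  have h2 : (C.dropUntil z hz).IsPath := by
    rw [← hsp] at hC
    exact hC.isPath_of_append_right (Walk.not_nil_of_ne hzx.symm)
  rcases hu' with h1 | h1
  · exact ⟨_, hC.isPath_takeUntil hz, C.support_takeUntil_subset_support hz, h1⟩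
  · exact ⟨(C.dropUntil z hz).reverse, h2.reverse, by
      rw [Walk.support_reverse]
      intro w hw
      exact C.support_dropUntil_subset_support hz (List.mem_reverse.1 hw), by simpa using h1⟩

theorem whitney {V : Type*} [Fintype V] {H : SimpleGraph V} (h : TwoConnected H) (u v : V) :
    ∃ (x : V) (w : H.Walk x x), w.IsCycle ∧ u ∈ w.support ∧ v ∈ w.support := by
  classical
  by_contra hn
  let T : Set V := {v | ∃ (x : V) (w : H.Walk x x), w.IsCycle ∧ u ∈ w.support ∧ v ∈ w.support}
  have hu : u ∈ T := by
    obtain ⟨x, w, hw, hu⟩ := whitney_base h u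
    exact ⟨x, w, hw, hu, hu⟩
  have huv : u ≠ v := by
    rintro rfl; exact hn hu
  obtain ⟨r, hr, hr'⟩ := third_vertex h.1 u v
  obtain ⟨x, y, hx, hy, -, -, hxy⟩ := h.cut r T hu hn hr.symm hr'.symm
  obtain ⟨x0, C0, hC0, hu0, hx0⟩ := hx
  have hC := hC0.rotate hx0
  have hsub : ∀ w, w ∈ (C0.rotate x hx0).support ↔ w ∈ C0.support := by
    intro w
    exact Walk.mem_support_rotate_iff C0 x hx0
  have hu1 := (hsub u).2 hu0
  revert hC hu1
  generalize C0.rotate x hx0 = C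
  intro hC hu1
  have hyC : y ∉ C.support := fun hh => hy ⟨x, C, hC, hu1, hh⟩
  -- a vertex on C other than x
  have hz0 : C.snd ∈ C.support := C.getVert_mem_support 1
  have hz0x : C.snd ≠ x := (C.adj_snd hC.not_nil).ne'
  obtain ⟨p, hp⟩ : ∃ p : H.Walk y C.snd, x ∉ p.support := by
    obtain ⟨p⟩ := (h.2 x).preconnected ⟨y, hxy.ne'⟩ ⟨C.snd, hz0x⟩
    obtain ⟨p', hp'⟩ := walk_out p
    exact ⟨p', fun hh => hp' _ hh rfl⟩
  obtain ⟨z, hz, q, hq1, hq2⟩ := first_hit {w | w ∈ C.support} p hz0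
  have hxq : x ∉ q.support := by
    intro hh
    exact hp (hq2 hh)
  have hzx : z ≠ x := by
    rintro rfl; exact hxq q.start_mem_support
  obtain ⟨A, hA, hAC, huA⟩ := arc C hC hz hzx hu1
  have hP : (A.append q.bypass).IsPath := by
    have hb := q.bypass_isPath
    rw [Walk.isPath_def, Walk.support_append, List.nodup_append']
    refine ⟨hA.support_nodup, hb.support_nodup.tail, ?_⟩
    intro w hw1 hw2
    have hwz := hq1 w (q.support_bypass_subset_support (List.mem_of_mem_tail hw2)) (hAC hw1)
    have := hb.support_nodup
    rw [← Walk.cons_tail_support] at this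
    rw [hwz] at hw2
    exact (List.nodup_cons.1 this).1 hw2
  apply hy
  refine ⟨y, Walk.cons hxy.symm (A.append q.bypass), ?_, ?_, by simp⟩
  · rw [Walk.cons_isCycle_iff]
    refine ⟨hP, ?_⟩
    rw [Walk.edges_append, List.mem_append]
    rintro (he | he)
    · exact hyC (hAC (A.fst_mem_support_of_mem_edges he))
    · exact hxq (q.support_bypass_subset_support (q.bypass.snd_mem_support_of_mem_edges he))
  · simp [Walk.mem_support_append_iff, huA]

structure EPart {V : Type*} (G : SimpleGraph V) (u v c : V) (U W : Set V) : Prop where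
  hu : u ∈ U
  hv : v ∈ W
  cU : c ∉ U
  cW : c ∉ W
  dis : ∀ x, x ∈ U → x ∉ W
  cov : ∀ x, x ∈ U ∨ x ∈ W ∨ x = c
  cross : ∀ x ∈ U, ∀ y ∈ W, G.Adj x y → x = u ∧ y = v
  adj : G.Adj u v

theorem EPart.symm {V : Type*} {G : SimpleGraph V} {u v c : V} {U W : Set V}
    (h : EPart G u v c U W) : EPart G v u c W U where
  hu := h.hv
  hv := h.hu
  cU := h.cW
  cW := h.cU
  dis := fun x hx hx' => h.dis x hx' hx
  cov := fun x => by rcases h.cov x with h | h | h <;> simp [h]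
  cross := fun x hx y hy hxy => (h.cross y hy x hx hxy.symm).symm
  adj := h.adj.symm

theorem exists_part {V : Type*} [Fintype V] {G : SimpleGraph V} (h2 : TwoConnected G)
    (hch : Chordless G) {u v : V} (huv : G.Adj u v) : ∃ c U W, EPart G u v c U W := by
  classical
  have hadj : ∀ {x y}, G.Adj x y → ¬ (x = u ∧ y = v) → ¬ (x = v ∧ y = u) →
      (G.deleteEdges {s(u, v)}).Adj x y := by
    intro x y hxy h1 h2
    simp [deleteEdges_adj, hxy, h1, h2]
  have hn : ¬ TwoConnected (G.deleteEdges {s(u, v)}) := fun hh => hch u v huv (whitney hh u v)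
  obtain ⟨c, hc⟩ : ∃ c, ¬ ((G.deleteEdges {s(u, v)}).induce {x | x ≠ c}).Connected := by
    by_contra hcon
    push Not at hcon
    exact hn ⟨h2.1, hcon⟩
  have key : ∃ s t : V, ∃ (hs : s ≠ c) (ht : t ≠ c),
      ¬ ((G.deleteEdges {s(u, v)}).induce {x | x ≠ c}).Reachable ⟨s, hs⟩ ⟨t, ht⟩ := by
    by_contra hcon
    push Not at hcon
    apply hc
    obtain ⟨z, hz, -⟩ := third_vertex h2.1 c c
    have : Nonempty ↥{x | x ≠ c} := ⟨⟨z, hz⟩⟩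
    exact ⟨fun s t => hcon s.1 t.1 s.2 t.2⟩
  obtain ⟨s, t, hs, ht, hst⟩ := key
  -- a closed set in the deleted graph
  have key2 : ∃ A : Set V, s ∈ A ∧ t ∉ A ∧ c ∉ A ∧ ∀ p q, p ∈ A → q ∉ A → q ≠ c →
      ¬ (G.deleteEdges {s(u, v)}).Adj p q := by
    by_contra hcon
    push Not at hcon
    apply hst
    apply reach_of_cut
    intro A hA hsA htA
    obtain ⟨p, q, hp, hq, hqc, hpq⟩ := hcon A hsA htA (fun hh => hA hh rfl)
    exact ⟨p, q, hp, hq, hqc, hpq⟩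
  obtain ⟨A, hsA, htA, hcA, hA⟩ := key2
  obtain ⟨p, q, hp, hq, hpc, hqc, hpq⟩ := h2.cut c A hsA htA hs ht
  have hpq' : (p = u ∧ q = v) ∨ (p = v ∧ q = u) := by
    by_contra hcon
    push Not at hcon
    exact hA p q hp hq hqc (hadj hpq (by tauto) (by tauto))
  have hP : EPart G p q c A {x | x ∉ A ∧ x ≠ c} := by
    refine ⟨hp, ⟨hq, hqc⟩, hcA, fun hh => hh.2 rfl, fun x hx hx' => hx'.1 hx, fun x => ?_, ?_, hpq⟩
    · by_cases hx : x ∈ A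
      · exact Or.inl hx
      · by_cases hx' : x = c
        · exact Or.inr (Or.inr hx')
        · exact Or.inr (Or.inl ⟨hx, hx'⟩)
    · intro x hx y hy hxy
      have : (x = u ∧ y = v) ∨ (x = v ∧ y = u) := by
        by_contra hcon
        exact hA x y hx hy.1 hy.2 (hadj hxy (by tauto) (by tauto))
      rcases this with ⟨rfl, rfl⟩ | ⟨rfl, rfl⟩ <;> rcases hpq' with ⟨rfl, rfl⟩ | ⟨rfl, rfl⟩
      · exact ⟨rfl, rfl⟩
      · exact absurd hp hy.1
      · exact absurd hp hy.1
      · exact ⟨rfl, rfl⟩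
  rcases hpq' with ⟨rfl, rfl⟩ | ⟨rfl, rfl⟩
  · exact ⟨c, _, _, hP⟩
  · exact ⟨c, _, _, hP.symm⟩

/-- three neighbours -/
theorem edeg_ge_three {V : Type*} [Finite V] {G : SimpleGraph V} {u : V} (h : 3 ≤ edeg G u) (v : V) :
    ∃ z1 z2, z1 ≠ z2 ∧ z1 ≠ v ∧ z2 ≠ v ∧ G.Adj u z1 ∧ G.Adj u z2 := by
  have h1 : 2 ≤ ({x | G.Adj u x} \ {v}).ncard := by
    have := Set.pred_ncard_le_ncard_sdiff_singleton {x | G.Adj u x} v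
    unfold edeg at h
    omega
  obtain ⟨z1, hz1, z2, hz2, hne⟩ := (Set.one_lt_ncard (Set.toFinite _)).1 h1
  exact ⟨z1, z2, hne, hz1.2, hz2.2, hz1.1, hz2.1⟩

theorem not_acyclic {V : Type*} [Fintype V] {G : SimpleGraph V} (h2 : TwoConnected G) {S : Set V}
    {s c z1 z2 : V} (hs : s ∈ S) (hcl : ∀ p ∈ S, p ≠ s → p ≠ c → ∀ q, G.Adj p q → q ∈ S)
    (h1 : z1 ∈ S) (h1' : z2 ∈ S) (hne : z1 ≠ z2) (hz1 : G.Adj s z1) (hz2 : G.Adj s z2) :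
    ¬ (G.induce S).IsAcyclic := by
  intro hac
  have hb := isAcyclic_iff_forall_adj_isBridge.1 hac
    (show (G.induce S).Adj ⟨s, hs⟩ ⟨z1, h1⟩ from hz1)
  rw [isBridge_iff] at hb
  apply hb
  symm
  apply reach_of_cut'
  intro A hA hsA
  by_cases h2A : (⟨z2, h1'⟩ : ↥S) ∈ A
  · refine ⟨_, _, h2A, hsA, ?_⟩
    rw [deleteEdges_adj]
    refine ⟨hz2.symm, ?_⟩
    simp [hne.symm, hz2.ne']
  have mk : ∀ p q : V, ∀ (hp : p ∈ S) (hq : q ∈ S), (⟨p, hp⟩ : ↥S) ∈ A → (⟨q, hq⟩ : ↥S) ∉ A →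
      p ≠ s → q ≠ s → G.Adj p q → ∃ p q, p ∈ A ∧ q ∉ A ∧
      ((G.induce S).deleteEdges {s((⟨s, hs⟩ : ↥S), ⟨z1, h1⟩)}).Adj p q := by
    intro p q hp hq hpA hqA hps hqs hpq
    refine ⟨_, _, hpA, hqA, ?_⟩
    rw [deleteEdges_adj]
    exact ⟨hpq, by simp [hps, hqs]⟩
  by_cases hcA : ∃ hc : c ∈ S, (⟨c, hc⟩ : ↥S) ∈ A
  · obtain ⟨p, q, hp, hq, hps, hqs, hpq⟩ := h2.cut s {x | ∀ hx : x ∈ S, (⟨x, hx⟩ : ↥S) ∈ A}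
      (s := z1) (t := z2) (fun _ => hA) (fun hh => h2A (hh h1')) hz1.ne' hz2.ne'
    simp only [Set.mem_ofPred_eq, not_forall] at hp hq
    obtain ⟨hqS, hqA⟩ := hq
    have hpS : p ∈ S := by
      refine hcl q hqS hqs ?_ p hpq.symm
      rintro rfl
      exact hqA hcA.2
    exact mk p q hpS hqS (hp hpS) hqA hps hqs hpq
  · obtain ⟨p, q, hp, hq, hps, hqs, hpq⟩ := h2.cut s {x | ∃ hx : x ∈ S, (⟨x, hx⟩ : ↥S) ∈ A}
      (s := z1) (t := z2) ⟨h1, hA⟩ (fun ⟨_, hh⟩ => h2A hh) hz1.ne' hz2.ne'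
    simp only [Set.mem_ofPred_eq, not_exists] at hp hq
    obtain ⟨hpS, hpA⟩ := hp
    have hqS : q ∈ S := by
      refine hcl p hpS hps ?_ q hpq
      rintro rfl
      exact hcA ⟨hpS, hpA⟩
    exact mk p q hpS hqS hpA (hq hqS) hps hqs hpq

theorem EPart.not_adj {V : Type*} [Fintype V] {G : SimpleGraph V} (h2 : TwoConnected G)
    (hch : Chordless G) {u v c : V} {U W : Set V} (h : EPart G u v c U W) (hu : 3 ≤ edeg G u) :
    ¬ G.Adj u c := by
  intro huc
  have hvc : v ≠ c := fun hh => h.cW (hh ▸ h.hv)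
  obtain ⟨z, hz, hzv, hzc⟩ : ∃ z, G.Adj u z ∧ z ≠ v ∧ z ≠ c := by
    obtain ⟨z1, z2, h1, h3, h4, h5, h6⟩ := edeg_ge_three hu v
    by_cases hh : z1 = c
    · exact ⟨z2, h6, h4, fun h' => h1 (hh.trans h'.symm)⟩
    · exact ⟨z1, h5, h3, hh⟩
  have hzU : z ∈ U := by
    rcases h.cov z with hh | hh | hh
    · exact hh
    · exact absurd (h.cross u h.hu z hh hz).2 hzv
    · exact absurd hh hzc
  have hzu : z ≠ u := hz.ne'
  have hvu : v ≠ u := h.adj.ne'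
  have hcu : c ≠ u := huc.ne'
  have hreach : ((G.deleteEdges {s(u, c)}).deleteEdges {s(u, v)}).Reachable u v := by
    apply reach_of_cut'
    intro A hA hvA
    have mk : ∀ p q, p ∈ A → q ∉ A → p ≠ u → q ≠ u → G.Adj p q → ∃ p q, p ∈ A ∧ q ∉ A ∧
        ((G.deleteEdges {s(u, c)}).deleteEdges {s(u, v)}).Adj p q := by
      intro p q hp hq hpu hqu hpq
      exact ⟨p, q, hp, hq, by simp [hpq, hpu, hqu]⟩
    by_cases hzA : z ∈ A
    swap
    · exact ⟨u, z, hA, hzA, by simp [hz, hzv, hzc, hzu]⟩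
    by_cases hcA : c ∈ A
    · obtain ⟨p, q, hp, hq, hps, hqs, hpq⟩ := h2.cut u (A ∪ U) (Or.inl hcA) (t := v)
        (by rintro (hh | hh); exacts [hvA hh, h.dis _ hh h.hv]) hcu hvu
      have hqA : q ∉ A := fun hh => hq (Or.inl hh)
      have hqU : q ∉ U := fun hh => hq (Or.inr hh)
      have hqc : q ≠ c := by rintro rfl; exact hqA hcA
      have hqW : q ∈ W := by rcases h.cov q with hh | hh | hh <;> tauto
      rcases hp with hp | hp
      · exact mk p q hp hqA hps hqs hpq
      · exact absurd (h.cross p hp q hqW hpq).1 hps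
    · obtain ⟨p, q, hp, hq, hps, hqs, hpq⟩ := h2.cut u (A ∩ U) ⟨hzA, hzU⟩ (t := v)
        (fun hh => hvA hh.1) hzu hvu
      have hqW : q ∉ W := fun hh => hps (h.cross p hp.2 q hh hpq).1
      have hqA : q ∉ A := by
        intro hh
        rcases h.cov q with h' | h' | h'
        · exact hq ⟨hh, h'⟩
        · exact hqW h'
        · exact hcA (h' ▸ hh)
      exact mk p q hp.1 hqA hps hqs hpq
  have hadj : (G.deleteEdges {s(u, c)}).Adj u v := by
    simp [h.adj, hvc, hvu]
  obtain ⟨x, w, hw, he⟩ := adj_and_reachable_delete_edges_iff_exists_cycle.1 ⟨hadj, hreach⟩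
  refine hch u c huc ⟨x, w, hw, w.fst_mem_support_of_mem_edges he, ?_⟩
  by_contra hcw
  let K : SimpleGraph V := G.deleteEdges {e | c ∈ e}
  have hK : ∀ e ∈ w.edges, e ∈ K.edgeSet := by
    intro e he
    have h1 := w.edges_subset_edgeSet he
    simp only [edgeSet_deleteEdges, Set.mem_sdiff] at h1
    simp only [K, edgeSet_deleteEdges, Set.mem_sdiff]
    refine ⟨h1.1, ?_⟩
    intro hce
    induction e with | h a b =>
    rcases Sym2.mem_iff.1 hce with rfl | rfl
    · exact hcw (w.fst_mem_support_of_mem_edges he)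
    · exact hcw (w.snd_mem_support_of_mem_edges he)
  have hr := (adj_and_reachable_delete_edges_iff_exists_cycle (G := K) (v := u) (w := v)).2
    ⟨x, w.transfer K hK, hw.transfer hK, by simpa using he⟩
  obtain ⟨p⟩ := hr.2
  obtain ⟨d, -, hd1, hd2⟩ := p.exists_boundary_dart U h.hu (fun hh => h.dis _ hh h.hv)
  have had := d.adj
  simp only [K, deleteEdges_adj, Set.mem_ofPred_eq, Sym2.mem_iff, not_or, Set.mem_singleton_iff] at had
  have hdW : d.snd ∈ W := by
    rcases h.cov d.snd with hh | hh | hh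
    · exact absurd hh hd2
    · exact hh
    · exact absurd hh.symm had.1.2.2
  obtain ⟨e1, e2⟩ := h.cross _ hd1 _ hdW had.1.1
  exact had.2 (by rw [e1, e2])

theorem block_ss {V : Type*} {G : SimpleGraph V} {X : Set V} {a b : V} (p q : ↥(X ∪ {a, b})) :
    (blockX G X a b).Adj (some p) (some q) ↔ G.Adj p q := by
  simp only [blockX, fromRel_adj]
  constructor
  · rintro ⟨-, h | h⟩
    exacts [h, h.symm]
  · intro h
    refine ⟨?_, Or.inl h⟩
    intro hh
    exact h.ne (congrArg Subtype.val (Option.some.inj hh))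

theorem block_sn {V : Type*} {G : SimpleGraph V} {X : Set V} {a b : V} (p : ↥(X ∪ {a, b})) :
    (blockX G X a b).Adj (some p) none ↔ (p : V) = a ∨ (p : V) = b := by
  simp [blockX, fromRel_adj]

theorem block_ns {V : Type*} {G : SimpleGraph V} {X : Set V} {a b : V} (p : ↥(X ∪ {a, b})) :
    (blockX G X a b).Adj none (some p) ↔ (p : V) = a ∨ (p : V) = b := by
  rw [adj_comm, block_sn]

theorem edeg_mark {V : Type*} {G : SimpleGraph V} {X : Set V} {a b : V} :
    edeg (blockX G X a b) none ≤ 2 := by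
  unfold edeg
  have : {u | (blockX G X a b).Adj none u} ⊆ {some ⟨a, by simp⟩, some ⟨b, by simp⟩} := by
    intro u hu
    cases u with
    | none => exact absurd hu (blockX G X a b).irrefl
    | some p =>
      rcases (block_ns (G := G) p).1 hu with h | h
      · left; congr 1; exact Subtype.ext h
      · right; congr 1; exact Subtype.ext h
  exact (Set.ncard_le_ncard this).trans (by
    refine (Set.ncard_insert_le _ _).trans ?_
    rw [Set.ncard_singleton])

theorem nbr_val {V : Type*} (G : SimpleGraph V) (S : Set V) (p : V) :
    {x : ↥S | G.Adj p x}.ncard = (S ∩ {x | G.Adj p x}).ncard := by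
  rw [← Set.ncard_image_of_injective _ Subtype.val_injective]
  congr 1
  ext x
  simp
  tauto

theorem edeg_end {V : Type*} [Finite V] {G : SimpleGraph V} {X : Set V} {a b : V}
    (p : ↥(X ∪ {a, b})) (hp : (p : V) = a ∨ (p : V) = b) (ha : ¬ G.Adj p a) (hb : ¬ G.Adj p b) :
    edeg (blockX G X a b) (some p) = 1 + (X ∩ {x | G.Adj p x}).ncard := by
  have h1 : {y | (blockX G X a b).Adj (some p) y} =
      insert none (some '' {x : ↥(X ∪ {a, b}) | G.Adj p x}) := by
    ext y
    cases y with
    | none => simpa [block_sn] using hp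
    | some q => simp [block_ss]
  have h2 : (X ∪ {a, b}) ∩ {x | G.Adj p x} = X ∩ {x | G.Adj p x} := by
    ext x
    constructor
    · rintro ⟨hx | rfl | rfl, hx'⟩
      exacts [⟨hx, hx'⟩, absurd hx' ha, absurd hx' hb]
    · rintro ⟨hx, hx'⟩
      exact ⟨Or.inl hx, hx'⟩
  unfold edeg
  rw [h1, Set.ncard_insert_of_notMem (by simp),
    Set.ncard_image_of_injective _ (Option.some_injective _), nbr_val, h2, add_comm]

theorem edeg_in {V : Type*} [Finite V] {G : SimpleGraph V} {X : Set V} {a b : V}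
    (p : ↥(X ∪ {a, b})) (ha : (p : V) ≠ a) (hb : (p : V) ≠ b) :
    edeg (blockX G X a b) (some p) ≤ edeg G p := by
  have h1 : {y | (blockX G X a b).Adj (some p) y} =
      (some '' {x : ↥(X ∪ {a, b}) | G.Adj p x}) := by
    ext y
    cases y with
    | none => simp [block_sn, ha, hb]
    | some q => simp [block_ss]
  unfold edeg
  rw [h1, Set.ncard_image_of_injective _ (Option.some_injective _), nbr_val]
  exact Set.ncard_le_ncard Set.inter_subset_right

theorem edeg_induce_le {V : Type*} [Finite V] (G : SimpleGraph V) (S : Set V) (p : ↥S) :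
    edeg (G.induce S) p ≤ edeg G p := by
  have : edeg (G.induce S) p = (S ∩ {x | G.Adj p x}).ncard := nbr_val G S p
  rw [this]
  exact Set.ncard_le_ncard Set.inter_subset_right

theorem edeg_induce_eq {V : Type*} [Finite V] (G : SimpleGraph V) (S : Set V) (p : ↥S)
    (h : ∀ q, G.Adj p q → q ∈ S) :
    edeg (G.induce S) p = edeg G p := by
  have : edeg (G.induce S) p = (S ∩ {x | G.Adj p x}).ncard := nbr_val G S p
  rw [this]
  unfold edeg
  congr 1
  ext x
  exact ⟨fun hx => hx.2, fun hx => ⟨h x hx, hx⟩⟩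

theorem edeg_iso {V V' : Type*} {G : SimpleGraph V} {G' : SimpleGraph V'} (f : G ≃g G') (x : V) :
    edeg G' (f x) = edeg G x := by
  unfold edeg
  rw [← Set.ncard_image_of_injective _ f.injective]
  congr 1
  ext y
  constructor
  · intro hy
    refine ⟨f.symm y, ?_, by simp⟩
    have : G'.Adj (f x) (f (f.symm y)) := by simpa using hy
    exact f.map_adj_iff.1 this
  · rintro ⟨z, hz, rfl⟩
    exact f.map_adj_iff.2 hz

def NonK {V : Type*} (G : SimpleGraph V) (X : Set V) (a b : V) : Prop :=
  ∀ t : ℕ, 3 ≤ t → IsEmpty (blockX G X a b ≃g completeBipartiteGraph (Fin 2) (Fin t))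

theorem edeg_bip (t : ℕ) (i : Fin 2) :
    edeg (completeBipartiteGraph (Fin 2) (Fin t)) (Sum.inl i) = t := by
  unfold edeg
  have : {u | (completeBipartiteGraph (Fin 2) (Fin t)).Adj (Sum.inl i) u} = Sum.inr '' Set.univ := by
    ext y
    cases y <;> simp [completeBipartiteGraph]
  rw [this, Set.ncard_image_of_injective _ Sum.inr_injective, Set.ncard_univ]
  simp

theorem nonK_of {V : Type*} {G : SimpleGraph V} {X : Set V} {a b : V}
    (p : ↥(X ∪ {a, b})) (hp : (p : V) = a ∨ (p : V) = b)
    (hd : edeg (blockX G X a b) (some p) ≤ 2) : NonK G X a b := by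
  intro t ht
  refine ⟨fun f => ?_⟩
  have hm : edeg (blockX G X a b) none ≤ 2 := edeg_mark
  have hadj := f.map_adj_iff.2 ((block_sn p).2 hp)
  rw [← edeg_iso f] at hd hm
  revert hd hm hadj
  generalize f (some p) = x
  generalize f none = y
  intro hd hm hadj
  rcases x with i | i
  · rw [edeg_bip] at hd; omega
  · rcases y with j | j
    · rw [edeg_bip] at hm; omega
    · simp [completeBipartiteGraph] at hadj

theorem NonK.symm {V : Type*} {G : SimpleGraph V} {X : Set V} {a b : V} (h : NonK G X a b) :
    NonK G X b a := by
  have hS : X ∪ {b, a} = X ∪ {a, b} := by rw [Set.pair_comm]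
  let e : ↥(X ∪ {b, a}) ≃ ↥(X ∪ {a, b}) := Equiv.setCongr hS
  have f : blockX G X b a ≃g blockX G X a b := by
    refine ⟨e.optionCongr, ?_⟩
    intro x y
    cases x with
    | none =>
      cases y with
      | none => simp
      | some q =>
        show (blockX G X a b).Adj none (some (e q)) ↔ _
        rw [block_ns, block_ns]
        exact or_comm
    | some p =>
      cases y with
      | none =>
        show (blockX G X a b).Adj (some (e p)) none ↔ _
        rw [block_sn, block_sn]
        exact or_comm
      | some q =>
        show (blockX G X a b).Adj (some (e p)) (some (e q)) ↔ _
        rw [block_ss, block_ss]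
        rfl
  intro t ht
  exact ⟨fun g => (h t ht).false (f.symm.trans g)⟩

theorem reach_congr {V : Type*} {G : SimpleGraph V} {S T : Set V} (h : S = T) {a b : V}
    (ha : a ∈ S) (hb : b ∈ S) (hr : (G.induce S).Reachable ⟨a, ha⟩ ⟨b, hb⟩) :
    (G.induce T).Reachable ⟨a, h ▸ ha⟩ ⟨b, h ▸ hb⟩ := by
  subst h; exact hr

theorem IsSplit.symm {V : Type*} {G : SimpleGraph V} {X Y : Set V} {a b : V}
    (h : IsSplit G X Y a b) : IsSplit G X Y b a := by
  obtain ⟨h1, h2, h3, h4, h5, h6, h7, h8, h9, h10, h11, h12, h13, h14, h15⟩ := h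
  refine ⟨h1.symm, fun hh => h2 hh.symm, h3, h4, h7, h8, h5, h6, h9, ?_, h11, ?_, ?_, ?_, ?_⟩
  · rw [Set.pair_comm]; exact h10
  · exact reach_congr (by rw [Set.pair_comm]) _ _ h12.symm
  · exact reach_congr (by rw [Set.pair_comm]) _ _ h13.symm
  · rw [Set.pair_comm]; exact h14
  · rw [Set.pair_comm]; exact h15

theorem EPart.split {V : Type*} [Fintype V] {G : SimpleGraph V} (h2 : TwoConnected G)
    (hch : Chordless G) {u v c : V} {U W : Set V} (h : EPart G u v c U W) (hu : 3 ≤ edeg G u)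
    (hv : 3 ≤ edeg G v) : IsSplit G W (U \ {u}) u c ∧ NonK G W u c := by
  have huc := h.not_adj h2 hch hu
  have hne : u ≠ c := fun hh => h.cU (hh ▸ h.hu)
  have hvc : v ≠ c := fun hh => h.cW (hh ▸ h.hv)
  have hvu : v ≠ u := h.adj.ne'
  have huW : u ∉ W := h.dis u h.hu
  obtain ⟨z1, z2, hz, hz1, hz2, ha1, ha2⟩ := edeg_ge_three hu v
  have inU : ∀ z, z ≠ v → G.Adj u z → z ∈ U := by
    intro z hz ha
    rcases h.cov z with hh | hh | hh
    · exact hh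
    · exact absurd (h.cross u h.hu z hh ha).2 hz
    · exact absurd (hh ▸ ha) huc
  refine ⟨⟨hne, huc, ⟨v, h.hv⟩, ⟨z1, inU z1 hz1 ha1, ha1.ne'⟩, huW, fun hh => hh.2 rfl, h.cW,
    fun hh => h.cU hh.1, ?_, ?_, ?_, ?_, ?_, ?_, ?_⟩, ?_⟩
  · rw [Set.disjoint_left]
    exact fun x hx hx' => h.dis x hx'.1 hx
  · ext x
    have := h.cov x
    simp
    tauto
  · rintro x hx y ⟨hy, hyu⟩ hxy
    exact hyu (h.cross y hy x hx hxy.symm).1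
  · apply reach_of_cut
    intro A hAS hA hcA
    by_cases hvA : v ∈ A
    swap
    · exact ⟨u, v, hA, hvA, Or.inl h.hv, h.adj⟩
    obtain ⟨p, q, hp, hq, hpu, hqu, hpq⟩ := h2.cut u (A ∩ W) (t := c) ⟨hvA, h.hv⟩
      (fun hh => hcA hh.1) hvu hne.symm
    have hqU : q ∉ U := fun hh => hqu (h.cross q hh p hp.2 hpq.symm).1
    rcases h.cov q with h' | h' | h'
    · exact absurd h' hqU
    · exact ⟨p, q, hp.1, fun hh => hq ⟨hh, h'⟩, Or.inl h', hpq⟩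
    · exact ⟨p, q, hp.1, fun hh => hcA (h' ▸ hh), Or.inr (Or.inr h'), hpq⟩
  · apply reach_of_cut
    intro A hAS hA hcA
    obtain ⟨p, q, hp, hq, hpu, hqu, hpq⟩ := h2.cut v (A ∩ U) (t := c) ⟨hA, h.hu⟩
      (fun hh => hcA hh.1) hvu.symm hvc.symm
    have hqW : q ∉ W := fun hh => hqu (h.cross p hp.2 q hh hpq).2
    rcases h.cov q with h' | h' | h'
    · refine ⟨p, q, hp.1, fun hh => hq ⟨hh, h'⟩, ?_, hpq⟩
      by_cases hh : q = u
      · right; left; exact hh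
      · left; exact ⟨h', hh⟩
    · exact absurd h' hqW
    · exact ⟨p, q, hp.1, fun hh => hcA (h' ▸ hh), Or.inr (Or.inr h'), hpq⟩
  · intro hp
    have h1 := hp.2.2 ⟨v, Or.inl h.hv⟩
    rw [edeg_induce_eq] at h1
    · simp only at h1; omega
    · intro q hq
      rcases h.cov q with h' | h' | h'
      · exact Or.inr (Or.inl (h.cross q h' v h.hv hq.symm).1)
      · exact Or.inl h'
      · exact Or.inr (Or.inr h')
  · intro hp
    refine not_acyclic h2 (S := U \ {u} ∪ {u, c}) (s := u) (c := c) (z1 := z1) (z2 := z2)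
      (by simp) ?_ (Or.inl ⟨inU z1 hz1 ha1, ha1.ne'⟩) (Or.inl ⟨inU z2 hz2 ha2, ha2.ne'⟩)
      hz ha1 ha2 hp.2.1
    intro p hp hpu hpc q hpq
    have hpU : p ∈ U := by
      rcases hp with h' | h' | h'
      exacts [h'.1, absurd h' hpu, absurd h' hpc]
    have hqW : q ∉ W := fun hh => hpu (h.cross p hpU q hh hpq).1
    have := h.cov q
    simp
    tauto
  · refine nonK_of ⟨u, by simp⟩ (Or.inl rfl) ?_
    rw [edeg_end _ (Or.inl rfl) G.irrefl huc]
    have : W ∩ {x | G.Adj u x} ⊆ {v} := by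
      rintro x ⟨hx, hx'⟩
      exact (h.cross u h.hu x hx hx').2
    have := Set.ncard_le_ncard this
    rw [Set.ncard_singleton] at this
    simp only
    omega

theorem IsSplit.nbr_a {V : Type*} {G : SimpleGraph V} {X Y : Set V} {a b : V}
    (h : IsSplit G X Y a b) : (∃ x ∈ X, G.Adj a x) ∧ (∃ y ∈ Y, G.Adj a y) := by
  obtain ⟨h1, h2, h3, h4, h5, h6, h7, h8, h9, h10, h11, h12, h13, h14, h15⟩ := h
  constructor
  · obtain ⟨p, q, hp, hq, -, hqS, hpq⟩ := cut_of_reach h12 {a} rfl h1.symm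
    obtain rfl : p = a := hp
    rcases hqS with hh | rfl | rfl
    · exact ⟨q, hh, hpq⟩
    · exact absurd hpq G.irrefl
    · exact absurd hpq h2
  · obtain ⟨p, q, hp, hq, -, hqS, hpq⟩ := cut_of_reach h13 {a} rfl h1.symm
    obtain rfl : p = a := hp
    rcases hqS with hh | rfl | rfl
    · exact ⟨q, hh, hpq⟩
    · exact absurd hpq G.irrefl
    · exact absurd hpq h2

theorem IsSplit.nbr {V : Type*} {G : SimpleGraph V} {X Y : Set V} {a b p : V}
    (h : IsSplit G X Y a b) (hp : p = a ∨ p = b) :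
    (∃ x ∈ X, G.Adj p x) ∧ (∃ y ∈ Y, G.Adj p y) := by
  rcases hp with rfl | rfl
  · exact h.nbr_a
  · exact h.symm.nbr_a

theorem IsSplit.edeg_end {V : Type*} [Finite V] {G : SimpleGraph V} {X Y : Set V} {a b : V}
    (h : IsSplit G X Y a b) (p : ↥(X ∪ {a, b})) (hp : (p : V) = a ∨ (p : V) = b) :
    edeg (blockX G X a b) (some p) = 1 + (X ∩ {x | G.Adj p x}).ncard := by
  have hab := h.2.1
  apply _root_.edeg_end p hp
  · rcases hp with hp | hp <;> rw [hp]
    · exact G.irrefl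
    · exact fun hh => hab hh.symm
  · rcases hp with hp | hp <;> rw [hp]
    · exact hab
    · exact G.irrefl

def Good {V : Type*} (G : SimpleGraph V) (X : Set V) (p : V) : Prop :=
  3 ≤ edeg G p ∧ (p ∉ X → ∃ x1 x2, x1 ≠ x2 ∧ x1 ∈ X ∧ x2 ∈ X ∧ G.Adj p x1 ∧ G.Adj p x2)

theorem IsSplit.good {V : Type*} [Finite V] {G : SimpleGraph V} {X Y : Set V} {a b : V}
    (h : IsSplit G X Y a b) (p : ↥(X ∪ {a, b})) (hd : 3 ≤ edeg (blockX G X a b) (some p)) :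
    Good G X p := by
  by_cases hp : (p : V) = a ∨ (p : V) = b
  · rw [h.edeg_end p hp] at hd
    have h1 : 1 < (X ∩ {x | G.Adj p x}).ncard := by omega
    obtain ⟨x1, hx1, x2, hx2, hne⟩ := (Set.one_lt_ncard (Set.toFinite _)).1 h1
    refine ⟨?_, fun _ => ⟨x1, x2, hne, hx1.1, hx2.1, hx1.2, hx2.2⟩⟩
    obtain ⟨y, hy, hpy⟩ := (h.nbr hp).2
    have hdis := h.2.2.2.2.2.2.2.2.1
    have hsub : insert y (X ∩ {x | G.Adj p x}) ⊆ {x | G.Adj p x} := by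
      rintro z (rfl | hz)
      exacts [hpy, hz.2]
    have h3 := Set.ncard_le_ncard hsub
    rw [Set.ncard_insert_of_notMem (fun hh => Set.disjoint_left.1 hdis hh.1 hy)] at h3
    unfold edeg
    omega
  · push Not at hp
    refine ⟨hd.trans (edeg_in p hp.1 hp.2), fun hX => ?_⟩
    rcases p.2 with hh | hh | hh
    exacts [absurd hh hX, absurd hh hp.1, absurd hh hp.2]

theorem min_false {V : Type*} [Fintype V] {G : SimpleGraph V} (h2 : TwoConnected G)
    (hch : Chordless G) {X : Set V}
    (hmin : ∀ (X' Y' : Set V) (a' b' : V), IsSplit G X' Y' a' b' → NonK G X' a' b' → ¬ X' ⊂ X)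
    {u v c : V} {U W : Set V} (h : EPart G u v c U W) (hu : Good G X u) (hv : Good G X v)
    (hW : W ⊆ X) : False := by
  obtain ⟨hs, hk⟩ := h.split h2 hch hu.1 hv.1
  apply hmin _ _ _ _ hs hk
  refine hW.ssubset_of_ne ?_
  rintro rfl
  obtain ⟨x1, x2, hne, hx1, hx2, ha1, ha2⟩ := hu.2 (h.dis u h.hu)
  exact hne ((h.cross u h.hu x1 hx1 ha1).2.trans (h.cross u h.hu x2 hx2 ha2).2.symm)

/-- if both ends lie on the `U` side, the `W` side is inside `X` -/
theorem side {V : Type*} [Fintype V] {G : SimpleGraph V} (h2 : TwoConnected G) {X Y : Set V}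
    {a b u v c : V} {U W : Set V} (hs : IsSplit G X Y a b) (h : EPart G u v c U W)
    (hvY : v ∉ Y) (ha : a ∉ W) (hb : b ∉ W) : W ⊆ X := by
  obtain ⟨-, -, -, -, -, -, -, -, hdis, hcov, hXY, -⟩ := hs
  have cov : ∀ x, x ∈ X ∨ x ∈ Y ∨ x = a ∨ x = b := by
    intro x
    have : x ∈ X ∪ Y ∪ {a, b} := hcov ▸ Set.mem_univ x
    simp at this
    tauto
  intro x hxW
  by_contra hxX
  have hxY : x ∈ Y := by
    rcases cov x with hh | hh | rfl | rfl <;> tauto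
  obtain ⟨p, q, hp, hq, hpc, hqc, hpq⟩ := h2.cut c (W ∩ Y) (t := u) ⟨hxW, hxY⟩
    (fun hh => h.dis u h.hu hh.1) (fun hh => h.cW (hh ▸ hxW)) (fun hh => h.cU (hh ▸ h.hu))
  have hqX : q ∉ X := fun hh => hXY q hh p hp.2 hpq.symm
  have hqW : q ∈ W := by
    rcases h.cov q with hh | hh | hh
    · exact absurd ((h.cross q hh p hp.1 hpq.symm).2 ▸ hp.2) hvY
    · exact hh
    · exact absurd hh hqc
  apply hq
  refine ⟨hqW, ?_⟩
  rcases cov q with hh | hh | rfl | rfl <;> tauto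

/-- the crossing case -/
theorem crossing {V : Type*} [Fintype V] {G : SimpleGraph V} (h2 : TwoConnected G)
    (hch : Chordless G) {X Y : Set V} {a b u v c : V} {U W : Set V} (hs : IsSplit G X Y a b)
    (hmin : ∀ (X' Y' : Set V) (a' b' : V), IsSplit G X' Y' a' b' → NonK G X' a' b' → ¬ X' ⊂ X)
    (h : EPart G u v c U W) (hu : Good G X u) (hv : Good G X v)
    (huX : u ∈ X) (ha : a ∈ U) (hb : b ∈ W) (hc : c ∈ Y) : False := by
  obtain ⟨-, -, -, -, haX, -, -, -, hdis, hcov, hXY, -⟩ := hs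
  have cov : ∀ x, x ∈ X ∨ x ∈ Y ∨ x = a ∨ x = b := by
    intro x
    have : x ∈ X ∪ Y ∪ {a, b} := hcov ▸ Set.mem_univ x
    simp at this
    tauto
  have hP : EPart G v u a {x | ¬ (x ∈ U ∧ x ∈ X) ∧ x ≠ a} (U ∩ X) := by
    refine ⟨⟨fun hh => h.dis v hh.1 h.hv, ?_⟩, ⟨h.hu, huX⟩, fun hh => hh.2 rfl, fun hh => haX hh.2,
      fun x hx hx' => hx.1 hx', ?_, ?_, h.adj.symm⟩
    · rintro rfl; exact h.dis v ha h.hv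
    · intro x
      by_cases hx : x ∈ U ∩ X
      · exact Or.inr (Or.inl hx)
      · by_cases hxa : x = a
        · exact Or.inr (Or.inr hxa)
        · exact Or.inl ⟨hx, hxa⟩
    · rintro x ⟨hx, hxa⟩ y ⟨hyU, hyX⟩ hxy
      have hxY : x ∉ Y := fun hh => hXY y hyX x hh hxy.symm
      have hxW : x ∈ W := by
        rcases h.cov x with hh | hh | hh
        · exfalso
          rcases cov x with h' | h' | h' | h'
          · exact hx ⟨hh, h'⟩
          · exact hxY h'
          · exact hxa h'
          · exact h.dis x hh (h' ▸ hb)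
        · exact hh
        · exact absurd (hh ▸ hc) hxY
      exact (h.cross y hyU x hxW hxy.symm).symm
  exact min_false h2 hch hmin hP hv hu Set.inter_subset_right

theorem sparse_of_min {V : Type*} [Fintype V] {G : SimpleGraph V} (h2 : TwoConnected G)
    (hch : Chordless G) {X Y : Set V} {a b : V} (hs : IsSplit G X Y a b)
    (hmin : ∀ (X' Y' : Set V) (a' b' : V), IsSplit G X' Y' a' b' → NonK G X' a' b' → ¬ X' ⊂ X) :
    TwoSparse (blockX G X a b) := by
  intro x y hxy
  by_contra hcon
  push Not at hcon
  obtain ⟨hx, hy⟩ := hcon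
  cases x with
  | none => exact absurd hx (not_lt.2 edeg_mark)
  | some u' =>
  cases y with
  | none => exact absurd hy (not_lt.2 edeg_mark)
  | some v' =>
  have huv := (block_ss u' v').1 hxy
  have hu := hs.good u' hx
  have hv := hs.good v' hy
  have memu : (u' : V) ∈ X ∨ (u' : V) = a ∨ (u' : V) = b := u'.2
  have memv : (v' : V) ∈ X ∨ (v' : V) = a ∨ (v' : V) = b := v'.2
  revert huv hu hv memu memv
  generalize (u' : V) = u
  generalize (v' : V) = v
  intro huv hu hv memu memv
  obtain ⟨hab, hnab, -, -, haX, haY, hbX, hbY, hdis, hcov, hXY, -, hrY, -⟩ := id hs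
  have notY : ∀ {u}, u ∈ X ∨ u = a ∨ u = b → u ∉ Y := by
    rintro u (hh | rfl | rfl)
    · exact Set.disjoint_left.1 hdis hh
    · exact haY
    · exact hbY
  obtain ⟨c, U, W, h⟩ := exists_part h2 hch huv
  by_cases h1 : a ∉ W ∧ b ∉ W
  · exact min_false h2 hch hmin h hu hv (side h2 hs h (notY memv) h1.1 h1.2)
  by_cases h3 : a ∉ U ∧ b ∉ U
  · exact min_false h2 hch hmin h.symm hv hu (side h2 hs h.symm (notY memu) h3.1 h3.2)
  -- reduce to a ∈ U, b ∈ W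
  have main : ∀ {a b u v : V} {U W : Set V}, IsSplit G X Y a b → EPart G u v c U W →
      Good G X u → Good G X v → u ∈ X ∨ u = a ∨ u = b → v ∈ X ∨ v = a ∨ v = b →
      a ∈ U → b ∈ W → False := by
    clear * - h2 hch hmin
    intro a b u v U W hs h hu hv memu memv ha hb
    obtain ⟨hab, hnab, -, -, haX, haY, hbX, hbY, hdis, hcov, hXY, -, hrY, -⟩ := id hs
    have hcY : c ∈ Y := by
      by_contra hcY
      obtain ⟨p, q, hp, hq, hpS, hqS, hpq⟩ := cut_of_reach hrY U ha (fun hh => h.dis _ hh hb)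
      have hcS : c ∉ Y ∪ {a, b} := by
        rintro (hh | rfl | rfl)
        exacts [hcY hh, h.cU ha, h.cW hb]
      have hqW : q ∈ W := by
        rcases h.cov q with hh | hh | hh
        · exact absurd hh hq
        · exact hh
        · exact absurd (hh ▸ hqS) hcS
      obtain ⟨rfl, rfl⟩ := h.cross p hp q hqW hpq
      have hpY : p ∉ Y := by
        rcases memu with hh | rfl | rfl
        exacts [Set.disjoint_left.1 hdis hh, haY, hbY]
      have hqY : q ∉ Y := by
        rcases memv with hh | rfl | rfl
        exacts [Set.disjoint_left.1 hdis hh, haY, hbY]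
      have hpa : p = a := by
        rcases hpS with hh | hh | hh
        · exact absurd hh hpY
        · exact hh
        · exact absurd (hh ▸ hp) (fun h' => h.dis _ h' hb)
      have hqb : q = b := by
        rcases hqS with hh | hh | hh
        · exact absurd hh hqY
        · exact absurd (hh ▸ hqW) (h.dis _ ha)
        · exact hh
      exact hnab (hpa ▸ hqb ▸ hpq)
    by_cases huX : u ∈ X
    · exact crossing h2 hch hs hmin h hu hv huX ha hb hcY
    · by_cases hvX : v ∈ X
      · exact crossing h2 hch hs.symm hmin h.symm hv hu hvX hb ha hcY
      · have hua : u = a := by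
          rcases memu with hh | hh | hh
          · exact absurd hh huX
          · exact hh
          · exact absurd (hh ▸ h.hu) (fun h' => h.dis _ h' hb)
        have hvb : v = b := by
          rcases memv with hh | hh | hh
          · exact absurd hh hvX
          · exact absurd (hh ▸ h.hv) (h.dis _ ha)
          · exact hh
        exact hnab (hua ▸ hvb ▸ h.adj)
  have key : (a ∈ U ∧ b ∈ W) ∨ (a ∈ W ∧ b ∈ U) := by
    have := h.dis a
    have := h.dis b
    tauto
  rcases key with ⟨ha, hb⟩ | ⟨ha, hb⟩
  · exact main hs h hu hv memu memv ha hb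
  · exact main hs h.symm hv hu memv memu ha hb

theorem conn_side {V : Type*} [Fintype V] {G : SimpleGraph V} (h2 : TwoConnected G) {Z : Set V}
    {a b : V} (hab : a ≠ b) (haZ : a ∉ Z) (hbZ : b ∉ Z)
    (hcl : ∀ p ∈ Z, ∀ q, G.Adj p q → q ∈ Z ∪ {a, b})
    (hr : (G.induce (Z ∪ {a, b})).Reachable ⟨a, by simp⟩ ⟨b, by simp⟩) :
    (G.induce (Z ∪ {a, b})).Connected := by
  have : Nonempty ↥(Z ∪ {a, b}) := ⟨⟨a, by simp⟩⟩
  refine ⟨fun s t => ?_⟩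
  apply reach_of_cut
  intro A hAS hsA htA
  by_cases haA : a ∈ A <;> by_cases hbA : b ∈ A
  · have htZ : (t : V) ∈ Z := by
      rcases t.2 with hh | hh | hh
      · exact hh
      · exact absurd (by rw [hh]; exact haA) htA
      · rw [Set.mem_singleton_iff] at hh
        exact absurd (by rw [hh]; exact hbA) htA
    obtain ⟨p, q, hp, hq, hpa, hqa, hpq⟩ := h2.cut a (Z \ A) (t := b) ⟨htZ, htA⟩
      (fun hh => hh.2 hbA) (fun hh => haZ (hh ▸ htZ)) hab.symm
    refine ⟨q, p, ?_, hp.2, Or.inl hp.1, hpq.symm⟩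
    rcases hcl p hp.1 q hpq with hh | hh | hh
    · by_contra h'
      exact hq ⟨hh, h'⟩
    · exact hh ▸ haA
    · rw [Set.mem_singleton_iff] at hh
      exact hh ▸ hbA
  · obtain ⟨p, q, hp, hq, hpS, hqS, hpq⟩ := cut_of_reach hr A haA hbA
    exact ⟨p, q, hp, hq, hqS, hpq⟩
  · obtain ⟨p, q, hp, hq, hpS, hqS, hpq⟩ := cut_of_reach hr.symm A hbA haA
    exact ⟨p, q, hp, hq, hqS, hpq⟩
  · obtain ⟨p, q, hp, hq, hpa, hqa, hpq⟩ := h2.cut a A (t := b) hsA hbA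
      (fun hh => haA (hh ▸ hsA)) hab.symm
    refine ⟨p, q, hp, hq, ?_, hpq⟩
    have hpZ : p ∈ Z := by
      rcases hAS hp with hh | hh | hh
      exacts [hh, absurd hh hpa, absurd (hh ▸ hp) hbA]
    exact hcl p hpZ q hpq

theorem path_mono {V : Type*} [Finite V] {G : SimpleGraph V} {S T : Set V} (hST : S ⊆ T)
    (hc : (G.induce S).Connected) (h : IsPathGraph (G.induce T)) : IsPathGraph (G.induce S) := by
  refine ⟨hc, h.2.1.embedding (G.induceHomOfLE hST), fun v => ?_⟩
  refine le_trans ?_ (h.2.2 ⟨v, hST v.2⟩)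
  have h1 : edeg (G.induce S) v = (S ∩ {x | G.Adj v x}).ncard := nbr_val G S v
  have h2 : edeg (G.induce T) ⟨v, hST v.2⟩ = (T ∩ {x | G.Adj v x}).ncard := nbr_val G T v
  rw [h1, h2]
  exact Set.ncard_le_ncard (Set.inter_subset_inter_left _ hST)

theorem IsSplit.cov {V : Type*} {G : SimpleGraph V} {X Y : Set V} {a b : V}
    (hs : IsSplit G X Y a b) (x : V) : x ∈ X ∨ x ∈ Y ∨ x = a ∨ x = b := by
  have hcov := hs.2.2.2.2.2.2.2.2.2.1
  have : x ∈ X ∪ Y ∪ {a, b} := hcov ▸ Set.mem_univ x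
  simp at this
  tauto

theorem IsSplit.conn {V : Type*} [Fintype V] {G : SimpleGraph V} (h2 : TwoConnected G)
    {X Y : Set V} {a b : V} (hs : IsSplit G X Y a b) :
    (G.induce (X ∪ {a, b})).Connected ∧ (G.induce (Y ∪ {a, b})).Connected := by
  obtain ⟨hab, hnab, -, -, haX, haY, hbX, hbY, hdis, hcov, hXY, hrX, hrY, -⟩ := id hs
  constructor
  · refine conn_side h2 hab haX hbX ?_ hrX
    intro p hp q hpq
    rcases hs.cov q with hh | hh | hh | hh
    · exact Or.inl hh
    · exact absurd hpq (hXY p hp q hh)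
    · exact Or.inr (Or.inl hh)
    · exact Or.inr (Or.inr hh)
  · refine conn_side h2 hab haY hbY ?_ hrY
    intro p hp q hpq
    rcases hs.cov q with hh | hh | hh | hh
    · exact absurd hpq.symm (hXY q hh p hp)
    · exact Or.inl hh
    · exact Or.inr (Or.inl hh)
    · exact Or.inr (Or.inr hh)

theorem acyclic_of_leaf {α : Type*} [Finite α] {K : SimpleGraph α} (hc : K.Connected)
    (hd : ∀ v, edeg K v ≤ 2) {a : α} (ha : edeg K a ≤ 1) : K.IsAcyclic := by
  intro v w hw
  have hsub : ∀ p, w.toSubgraph.neighborSet p ⊆ {x | K.Adj p x} := fun p x hx =>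
    w.toSubgraph.adj_sub hx
  by_cases hA : a ∈ w.support
  · have h1 := Set.ncard_le_ncard (hsub a)
    rw [hw.ncard_neighborSet_toSubgraph_eq_two hA] at h1
    unfold edeg at ha
    omega
  · obtain ⟨r⟩ := hc.preconnected v a
    obtain ⟨d, -, h1, h2⟩ := r.exists_boundary_dart {x | x ∈ w.support} w.start_mem_support hA
    have h3 : insert d.snd (w.toSubgraph.neighborSet d.fst) ⊆ {x | K.Adj d.fst x} := by
      rintro x (rfl | hx)
      exacts [d.adj, hsub _ hx]
    have h4 := Set.ncard_le_ncard h3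
    rw [Set.ncard_insert_of_notMem, hw.ncard_neighborSet_toSubgraph_eq_two h1] at h4
    · have := hd d.fst
      unfold edeg at this
      omega
    · intro hh
      apply h2
      have : d.snd ∈ w.toSubgraph.verts := w.toSubgraph.edge_vert (Subgraph.Adj.symm hh)
      exact w.mem_verts_toSubgraph.1 this

theorem exists_deg3 {V : Type*} [Fintype V] {G : SimpleGraph V} (h2 : TwoConnected G)
    {X Y : Set V} {a b : V} (hs : IsSplit G X Y a b) (ha : (X ∩ {x | G.Adj a x}).ncard ≤ 1)
    (hb : (X ∩ {x | G.Adj b x}).ncard ≤ 1) : ∃ x ∈ X, 3 ≤ edeg G x := by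
  by_contra hcon
  push Not at hcon
  obtain ⟨hab, hnab, -, -, haX, haY, hbX, hbY, hdis, hcov, hXY, hrX, hrY, hpX, hpY⟩ := id hs
  apply hpX
  have hconn := (hs.conn h2).1
  have key : ∀ p : ↥(X ∪ {a, b}), ((p : V) = a ∨ (p : V) = b) →
      edeg (G.induce (X ∪ {a, b})) p ≤ 1 := by
    intro p hp
    have h1 : edeg (G.induce (X ∪ {a, b})) p = ((X ∪ {a, b}) ∩ {x | G.Adj p x}).ncard :=
      nbr_val G _ p
    have h3 : (X ∪ {a, b}) ∩ {x | G.Adj p x} ⊆ X ∩ {x | G.Adj p x} := by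
      rintro x ⟨hx | hx | hx, hx'⟩
      · exact ⟨hx, hx'⟩
      · subst hx
        rcases hp with hp | hp <;> rw [hp] at hx'
        · exact absurd hx' G.irrefl
        · exact absurd hx'.symm hnab
      · rw [Set.mem_singleton_iff] at hx
        subst hx
        rcases hp with hp | hp <;> rw [hp] at hx'
        · exact absurd hx' hnab
        · exact absurd hx' G.irrefl
    rw [h1]
    refine (Set.ncard_le_ncard h3).trans ?_
    rcases hp with hp | hp <;> rw [hp]
    exacts [ha, hb]
  have hd : ∀ p, edeg (G.induce (X ∪ {a, b})) p ≤ 2 := by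
    intro p
    rcases p.2 with hp | hp
    · have h3 := hcon p hp
      have := edeg_induce_le G _ p
      omega
    · have := key p hp
      omega
  exact ⟨hconn, acyclic_of_leaf hconn hd (key ⟨a, by simp⟩ (Or.inl rfl)), hd⟩

theorem not_both_one {V : Type*} [Fintype V] {G : SimpleGraph V} (h2 : TwoConnected G)
    {X Y : Set V} {a b : V} (hs : IsSplit G X Y a b)
    (hmin : ∀ (X' Y' : Set V) (a' b' : V), IsSplit G X' Y' a' b' → NonK G X' a' b' → ¬ X' ⊂ X)
    (ha : (X ∩ {x | G.Adj a x}).ncard ≤ 1) (hb : (X ∩ {x | G.Adj b x}).ncard ≤ 1) : False := by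
  obtain ⟨d, hdX, hd⟩ := exists_deg3 h2 hs ha hb
  obtain ⟨a', haX', haa'⟩ := hs.nbr_a.1
  obtain ⟨hab, hnab, -, hYne, haX, haY, hbX, hbY, hdis, hcov, hXY, hrX, hrY, hpX, hpY⟩ := id hs
  have ua : ∀ x ∈ X, G.Adj a x → x = a' := fun x hx hx' =>
    (Set.ncard_le_one (Set.toFinite _)).1 ha x ⟨hx, hx'⟩ a' ⟨haX', haa'⟩
  have ub : ∀ x ∈ X, ∀ y ∈ X, G.Adj b x → G.Adj b y → x = y := fun x hx y hy hx' hy' =>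
    (Set.ncard_le_one (Set.toFinite _)).1 hb x ⟨hx, hx'⟩ y ⟨hy, hy'⟩
  have cl : ∀ p ∈ X, ∀ q, G.Adj p q → q ∈ X ∨ q = a ∨ q = b := by
    intro p hp q hpq
    rcases hs.cov q with hh | hh | hh
    · exact Or.inl hh
    · exact absurd hpq (hXY p hp q hh)
    · exact Or.inr hh
  have ha'b' : a' ≠ b := fun hh => hbX (hh ▸ haX')
  have ha'a : a' ≠ a := haa'.ne'
  have ha'Y : a' ∉ Y := Set.disjoint_left.1 hdis haX'
  -- there is another vertex in X
  have hz : ∃ z ∈ X, z ≠ a' := by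
    by_contra hcon
    push Not at hcon
    have hda := hcon d hdX
    subst hda
    obtain ⟨z1, z2, hne, h1, h3, h4, h5⟩ := edeg_ge_three hd a
    have : ∀ z, z ≠ a → G.Adj d z → z = b := by
      intro z hza hdz
      rcases cl d hdX z hdz with hh | hh | hh
      · exact absurd (hcon z hh) hdz.ne'
      · exact absurd hh hza
      · exact hh
    exact hne ((this z1 h1 h4).trans (this z2 h3 h5).symm)
  obtain ⟨z, hzX, hza'⟩ := hz
  have hna'b : ¬ G.Adj a' b := by
    intro hadj
    obtain ⟨p, q, hp, hq, hpa, hqa, hpq⟩ := h2.cut a' X (t := a) hzX haX hza' ha'a.symm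
    rcases cl p hp q hpq with hh | rfl | rfl
    · exact hq hh
    · exact hpa (ua p hp hpq.symm)
    · exact hpa (ub p hp a' haX' hpq.symm hadj.symm)
  have hXS : ∀ q, q ∈ X ∨ q = b → q ∈ X \ {a'} ∪ {a', b} := by
    rintro q (hh | hh)
    · by_cases h' : q = a'
      · exact Or.inr (Or.inl h')
      · exact Or.inl ⟨hh, h'⟩
    · exact Or.inr (Or.inr hh)
  have cl' : ∀ p ∈ X, p ≠ a' → ∀ q, G.Adj p q → q ∈ X ∨ q = b := by
    intro p hp hpa q hpq
    rcases cl p hp q hpq with hh | rfl | hh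
    · exact Or.inl hh
    · exact absurd (ua p hp hpq.symm) hpa
    · exact Or.inr hh
  have hs' : IsSplit G (X \ {a'}) (Y ∪ {a}) a' b := by
    refine ⟨ha'b', hna'b, ⟨z, hzX, hza'⟩, hYne.inl, fun hh => hh.2 rfl, ?_, fun hh => hbX hh.1, ?_,
      ?_, ?_, ?_, ?_, ?_, ?_, ?_⟩
    · rintro (hh | hh)
      exacts [ha'Y hh, ha'a hh]
    · rintro (hh | hh)
      exacts [hbY hh, hab hh.symm]
    · rw [Set.disjoint_left]
      rintro x ⟨hx, -⟩ (hh | hh)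
      · exact Set.disjoint_left.1 hdis hx hh
      · exact haX (hh ▸ hx)
    · ext x
      have := hs.cov x
      simp
      tauto
    · rintro x ⟨hx, hxa⟩ y (hy | hy) hxy
      · exact hXY x hx y hy hxy
      · rw [Set.mem_singleton_iff] at hy
        subst hy
        exact hxa (ua x hx hxy.symm)
    · apply reach_of_cut
      intro A hAS hA hbA
      obtain ⟨p, q, hp, hq, hpa, hqa, hpq⟩ := h2.cut a (A ∩ X) (t := b) ⟨hA, haX'⟩
        (fun hh => hbA hh.1) ha'a hab.symm
      rcases cl p hp.2 q hpq with hh | hh | hh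
      · exact ⟨p, q, hp.1, fun h' => hq ⟨h', hh⟩, hXS q (Or.inl hh), hpq⟩
      · exact absurd hh hqa
      · exact ⟨p, q, hp.1, fun h' => hbA (hh ▸ h'), hXS q (Or.inr hh), hpq⟩
    · apply reach_of_cut
      intro A hAS hA hbA
      by_cases haA : a ∈ A
      · obtain ⟨p, q, hp, hq, hpS, hqS, hpq⟩ := cut_of_reach hrY A haA hbA
        refine ⟨p, q, hp, hq, ?_, hpq⟩
        rcases hqS with hh | hh | hh
        · exact Or.inl (Or.inl hh)
        · exact Or.inl (Or.inr hh)
        · exact Or.inr (Or.inr hh)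
      · exact ⟨a', a, hA, haA, Or.inl (Or.inr rfl), haa'.symm⟩
    · intro hp
      by_cases hda : d = a'
      · subst hda
        obtain ⟨z1, z2, hne, h1, h3, h4, h5⟩ := edeg_ge_three hd a
        have inS : ∀ z, z ≠ a → G.Adj d z → z ∈ X \ {d} ∪ {d, b} := by
          intro z hza hdz
          rcases cl d hdX z hdz with hh | hh | hh
          · exact hXS z (Or.inl hh)
          · exact absurd hh hza
          · exact hXS z (Or.inr hh)
        refine not_acyclic h2 (s := d) (c := b) (hXS d (Or.inl hdX)) ?_ (inS z1 h1 h4)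
          (inS z2 h3 h5) hne h4 h5 hp.2.1
        intro p hp hpd hpb q hpq
        have hpX : p ∈ X := by
          rcases hp with hh | hh | hh
          exacts [hh.1, absurd hh hpd, absurd hh hpb]
        exact hXS q (cl' p hpX hpd q hpq)
      · have h1 := hp.2.2 ⟨d, Or.inl ⟨hdX, hda⟩⟩
        rw [edeg_induce_eq] at h1
        · simp only at h1; omega
        · intro q hq
          exact hXS q (cl' d hdX hda q hq)
    · intro hp
      apply hpY
      refine path_mono ?_ (hs.conn h2).2 hp
      rintro x (hh | hh | hh)
      · exact Or.inl (Or.inl hh)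
      · exact Or.inl (Or.inr hh)
      · exact Or.inr (Or.inr hh)
  refine hmin _ _ _ _ hs' (nonK_of ⟨b, by simp⟩ (Or.inr rfl) ?_) ?_
  · rw [hs'.edeg_end _ (Or.inr rfl)]
    have : X \ {a'} ∩ {x | G.Adj b x} ⊆ X ∩ {x | G.Adj b x} :=
      Set.inter_subset_inter_left _ Set.sdiff_subset
    have := Set.ncard_le_ncard this
    simp only
    omega
  · refine Set.sdiff_subset.ssubset_of_ne ?_
    intro hh
    have : a' ∈ X \ {a'} := by rw [hh]; exact haX'
    exact this.2 rfl

theorem exists_min {V : Type*} [Fintype V] {G : SimpleGraph V} (h2 : TwoConnected G)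
    (hch : Chordless G) (hns : ¬ TwoSparse G) :
    ∃ (X Y : Set V) (a b : V), IsSplit G X Y a b ∧ NonK G X a b ∧
    ∀ (X' Y' : Set V) (a' b' : V), IsSplit G X' Y' a' b' → NonK G X' a' b' → ¬ X' ⊂ X := by
  have hex : ∃ X : Set V, ∃ (Y : Set V) (a b : V), IsSplit G X Y a b ∧ NonK G X a b := by
    unfold TwoSparse at hns
    push Not at hns
    obtain ⟨u, v, huv, hu, hv⟩ := hns
    obtain ⟨c, U, W, h⟩ := exists_part h2 hch huv
    exact ⟨_, _, _, _, h.split h2 hch hu hv⟩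
  obtain ⟨X, ⟨Y, a, b, hs, hk⟩, hmin⟩ := WellFounded.has_min
    (wellFounded_lt : WellFounded ((· < ·) : Set V → Set V → Prop))
    {X | ∃ (Y : Set V) (a b : V), IsSplit G X Y a b ∧ NonK G X a b} hex
  exact ⟨X, Y, a, b, hs, hk, fun X' Y' a' b' hs' hk' => hmin X' ⟨Y', a', b', hs', hk'⟩⟩

theorem stmt8 {V : Type*} [Fintype V] (G : SimpleGraph V) (h2c : TwoConnected G)
    (hch : Chordless G) (hns : ¬ TwoSparse G) :
    ∃ (X Y : Set V) (a b : V), IsSplit G X Y a b ∧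
      TwoSparse (blockX G X a b) ∧
      (∀ t : ℕ, 3 ≤ t →
        IsEmpty (blockX G X a b ≃g completeBipartiteGraph (Fin 2) (Fin t))) ∧
      3 ≤ edeg (blockX G X a b) (some ⟨a, by simp⟩) ∧
      (3 ≤ edeg (blockX G X a b) (some ⟨b, by simp⟩) ∨
        (edeg (blockX G X a b) (some ⟨b, by simp⟩) = 2 ∧
          ∀ (X' Y' : Set V) (a' b' : V), IsSplit G X' Y' a' b' →
            TwoSparse (blockX G X' a' b') →
            (∀ t : ℕ, 3 ≤ t →
              IsEmpty (blockX G X' a' b' ≃g completeBipartiteGraph (Fin 2) (Fin t))) →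
            ¬ X' ⊂ X)) := by
  obtain ⟨X, Y, a0, b0, hs0, hk0, hmin⟩ := exists_min h2c hch hns
  obtain ⟨a, b, hs, hk, ha⟩ : ∃ a b, IsSplit G X Y a b ∧ NonK G X a b ∧
      2 ≤ (X ∩ {x | G.Adj a x}).ncard := by
    by_cases ha : 2 ≤ (X ∩ {x | G.Adj a0 x}).ncard
    · exact ⟨a0, b0, hs0, hk0, ha⟩
    by_cases hb : 2 ≤ (X ∩ {x | G.Adj b0 x}).ncard
    · exact ⟨b0, a0, hs0.symm, hk0.symm, hb⟩
    exact (not_both_one h2c hs0 hmin (by omega) (by omega)).elim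
  refine ⟨X, Y, a, b, hs, sparse_of_min h2c hch hs hmin, hk, ?_, ?_⟩
  · rw [hs.edeg_end _ (Or.inl rfl)]
    simp only
    omega
  · rw [hs.edeg_end _ (Or.inr rfl)]
    obtain ⟨x, hx, hbx⟩ := (hs.nbr (Or.inr rfl)).1
    have h1 : 0 < (X ∩ {x | G.Adj b x}).ncard := (Set.ncard_pos).2 ⟨x, hx, hbx⟩
    simp only
    by_cases h3 : 2 ≤ (X ∩ {x | G.Adj b x}).ncard
    · left; omega
    · right
      exact ⟨by omega, fun X' Y' a' b' hs' _ hk' => hmin X' Y' a' b' hs' hk'⟩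
end
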